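/- There exists a constant C > 0 such that for all real H ≥ 2 one has N_{V₄}(H) + N_{C₄}(H) ≤ C·H²·log H. -/

import Mathlib

open Polynomial in
/-- The number of monic, irreducible quartic polynomials with integer coefficients
bounded by `H` in absolute value whose Galois group is isomorphic to `G`. -/
noncomputable def quarticGalCount (G : Type*) [Group G] (H : ℝ) : ℕ :=
  Set.ncard {p : ℤ × ℤ × ℤ × ℤ |
    |(p.1 : ℝ)| ≤ H ∧ |(p.2.1 : ℝ)| ≤ H ∧ |(p.2.2.1 : ℝ)| ≤ H ∧ |(p.2.2.2 : ℝ)| ≤ H ∧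
    Irreducible (X ^ 4 + C (p.1 : ℚ) * X ^ 3 + C (p.2.1 : ℚ) * X ^ 2 + C (p.2.2.1 : ℚ) * X
        + C (p.2.2.2 : ℚ)) ∧
    Nonempty
      ((X ^ 4 + C (p.1 : ℚ) * X ^ 3 + C (p.2.1 : ℚ) * X ^ 2 + C (p.2.2.1 : ℚ) * X
          + C (p.2.2.2 : ℚ)).Gal ≃* G)}

theorem exists_involution_of_card_eq_four {G : Type*} [Group G] (hG : Nat.card G = 4) :
    ∃ τ σ : G, τ ≠ 1 ∧ σ ≠ 1 ∧ τ * σ ≠ 1 ∧ τ * τ = 1 ∧ σ ≠ τ ∧ σ * τ = τ * σ ∧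
      (σ * σ = 1 ∨ σ * σ = τ) ∧ ∀ g : G, g = 1 ∨ g = τ ∨ g = σ ∨ g = τ * σ := by
  classical
  have : Finite G := Nat.finite_of_card_ne_zero (by omega)
  have := Fintype.ofFinite G
  have : Fact (Nat.Prime 2) := ⟨Nat.prime_two⟩
  have hF : Fintype.card G = 4 := by rw [← Nat.card_eq_fintype_card, hG]
  obtain ⟨τ, hτ⟩ := exists_prime_orderOf_dvd_card (G := G) 2 (by rw [hF]; norm_num)
  have hτ1 : τ ≠ 1 := by
    rintro rfl
    simp at hτ
  have hττ : τ * τ = 1 := by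
    have := pow_orderOf_eq_one τ
    rwa [hτ, pow_two] at this
  have hcomm : ∀ a b : G, a * b = b * a :=
    (IsPGroup.isMulCommutative_of_card_eq_prime_sq (p := 2) (by rw [hG]; norm_num)).is_comm.comm
  obtain ⟨σ, hσ⟩ : ∃ σ : G, σ ∉ ({1, τ} : Finset G) := by
    by_contra! h
    have h1 : (Finset.univ : Finset G) ⊆ {1, τ} := fun x _ => h x
    have h2 := Finset.card_le_card h1
    rw [Finset.card_univ, hF] at h2
    have h3 := Finset.card_le_two (a := (1 : G)) (b := τ)
    omega
  simp only [Finset.mem_insert, Finset.mem_singleton, not_or] at hσ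
  obtain ⟨hσ1, hστ⟩ := hσ
  have hτσ : τ * σ ≠ 1 := by
    intro h
    exact hστ (mul_left_cancel (h.trans hττ.symm))
  have hall : ∀ g : G, g = 1 ∨ g = τ ∨ g = σ ∨ g = τ * σ := by
    have hc : ({1, τ, σ, τ * σ} : Finset G).card = 4 := by
      rw [Finset.card_insert_of_notMem, Finset.card_insert_of_notMem,
        Finset.card_insert_of_notMem, Finset.card_singleton]
      · simpa using fun h => hτ1 h
      · simp only [Finset.mem_insert, Finset.mem_singleton, not_or]
        exact ⟨fun h => hστ h.symm, by simpa using hσ1⟩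
      · simp only [Finset.mem_insert, Finset.mem_singleton, not_or]
        exact ⟨hτ1.symm, Ne.symm hσ1, hτσ.symm⟩
    intro g
    have : g ∈ ({1, τ, σ, τ * σ} : Finset G) := by
      rw [Finset.eq_univ_of_card _ (hc.trans hF.symm)]
      exact Finset.mem_univ g
    simpa using this
  refine ⟨τ, σ, hτ1, hσ1, hτσ, hττ, hστ, hcomm _ _, ?_, hall⟩
  rcases hall (σ * σ) with h | h | h | h
  · exact Or.inl h
  · exact Or.inr h
  · exact absurd (mul_eq_left.mp h) hσ1
  · exact absurd (mul_right_cancel h) hστ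

theorem exists_int_of_isIntegral_of_fixed {K : Type*} [Field K] [Algebra ℚ K]
    [FiniteDimensional ℚ K] [IsGalois ℚ K] {x : K} (hx : IsIntegral ℤ x)
    (hfix : ∀ g : K ≃ₐ[ℚ] K, g x = x) : ∃ n : ℤ, (n : K) = x := by
  obtain ⟨q, hq⟩ := (IsGalois.mem_range_algebraMap_iff_fixed x).mpr hfix
  have hqi : IsIntegral ℤ q := by
    rw [← hq] at hx
    exact (isIntegral_algebraMap_iff (algebraMap ℚ K).injective).mp hx
  obtain ⟨n, hn⟩ := IsIntegrallyClosed.isIntegral_iff.mp hqi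
  refine ⟨n, ?_⟩
  rw [← hq, ← hn]
  simp

open Polynomial in
theorem exists_resolvent_root_of_finrank_eq_four {K : Type*} [Field K] [Algebra ℚ K]
    [FiniteDimensional ℚ K] [IsGalois ℚ K] (hfr : Module.finrank ℚ K = 4) {a b c d : ℤ}
    (hirr : Irreducible (X ^ 4 + C (a : ℚ) * X ^ 3 + C (b : ℚ) * X ^ 2 + C (c : ℚ) * X
        + C (d : ℚ))) {α : K}
    (hα : α ^ 4 + a * α ^ 3 + b * α ^ 2 + c * α + d = 0) :
    ∃ x y : ℤ, (a ^ 2 - 4 * b + 4 * x) * (x ^ 2 - 4 * d) = (2 * c - a * x) ^ 2 ∧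
      ¬(a ^ 2 - 4 * b + 4 * x = 0 ∧ x ^ 2 - 4 * d = 0) ∧
      ((b - x) ^ 2 - 4 * a * c + 4 * (b - x) * x + 16 * d = y ^ 2 ∨
        (a ^ 2 - 4 * b + 4 * x) * ((b - x) ^ 2 - 4 * a * c + 4 * (b - x) * x + 16 * d)
          = y ^ 2) := by
  have : CharZero K := charZero_of_injective_algebraMap (algebraMap ℚ K).injective
  set f : ℚ[X] := X ^ 4 + C (a : ℚ) * X ^ 3 + C (b : ℚ) * X ^ 2 + C (c : ℚ) * X
        + C (d : ℚ) with hf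
  have hdeg : f.natDegree = 4 := by rw [hf]; compute_degree!
  have hmonic : f.Monic := by rw [hf]; monicity!
  have heval : ∀ z : K, aeval z f = z ^ 4 + a * z ^ 3 + b * z ^ 2 + c * z + d := by
    intro z
    simp [hf]
  have hmin : minpoly ℚ α = f :=
    (minpoly.eq_of_irreducible_of_monic hirr (by rw [heval, hα]) hmonic).symm
  have hroot : ∀ g : K ≃ₐ[ℚ] K, (g α) ^ 4 + a * (g α) ^ 3 + b * (g α) ^ 2 + c * (g α) + d = 0 := by
    intro g
    have := congrArg g hα
    simpa using this
  have hgen : IntermediateField.adjoin ℚ {α} = ⊤ := by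
    rw [Field.primitive_element_iff_minpoly_natDegree_eq, hmin, hdeg, hfr]
  have hinj : ∀ g h : K ≃ₐ[ℚ] K, g α = h α → g = h := by
    intro g h hgh
    have h1 : (g : K →ₐ[ℚ] K) = h :=
      (Field.primitive_element_iff_algHom_eq_of_eval' ℚ K (fun x => Normal.splits inferInstance x) α).mp
        hgen hgh
    exact AlgEquiv.coe_toAlgHom_injective h1
  have hcard : Nat.card (K ≃ₐ[ℚ] K) = 4 := by rw [IsGalois.card_aut_eq_finrank, hfr]
  obtain ⟨τ, σ, hτ1, hσ1, hτσ1, hττ, hστ, hcomm, hσσ, hall⟩ :=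
    exists_involution_of_card_eq_four hcard
  set α₂ := τ α with hα₂
  set α₃ := σ α with hα₃
  set α₄ := (τ * σ) α with hα₄
  have hτ₂ : τ α₂ = α := by rw [hα₂, ← AlgEquiv.mul_apply, hττ, AlgEquiv.one_apply]
  have hτ₃ : τ α₃ = α₄ := by rw [hα₃, hα₄, AlgEquiv.mul_apply]
  have hτ₄ : τ α₄ = α₃ := by
    rw [hα₃, hα₄, ← AlgEquiv.mul_apply, ← mul_assoc, hττ, one_mul]
  have hσ₂ : σ α₂ = α₄ := by rw [hα₂, hα₄, ← AlgEquiv.mul_apply, hcomm]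
  have n12 : α ≠ α₂ := fun h => hτ1 (hinj τ 1 h.symm)
  have n13 : α ≠ α₃ := fun h => hσ1 (hinj σ 1 h.symm)
  have n14 : α ≠ α₄ := fun h => hτσ1 (hinj _ 1 h.symm)
  have n23 : α₂ ≠ α₃ := fun h => hστ (hinj _ _ h).symm
  have n24 : α₂ ≠ α₄ := fun h => n13 (by rw [← hτ₂, h, hτ₄])
  have n34 : α₃ ≠ α₄ := fun h => n12 (by
    apply σ.injective
    rw [hσ₂, ← hα₃, h])
  have hfix : ∀ z : K, IsIntegral ℤ z → τ z = z → σ z = z → ∃ n : ℤ, (n : K) = z := by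
    intro z hz h1 h2
    refine exists_int_of_isIntegral_of_fixed hz fun g => ?_
    rcases hall g with rfl | rfl | rfl | rfl
    · rfl
    · exact h1
    · exact h2
    · rw [AlgEquiv.mul_apply, h2, h1]
  have hint : ∀ g : K ≃ₐ[ℚ] K, IsIntegral ℤ (g α) := by
    intro g
    refine ⟨X ^ 4 + C a * X ^ 3 + C b * X ^ 2 + C c * X + C d, by monicity!, ?_⟩
    simp only [eval₂_add, eval₂_mul, eval₂_pow, eval₂_X, eval₂_C]
    simpa only [eq_intCast] using hroot g
  have i1 : IsIntegral ℤ α := hint 1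
  have i2 : IsIntegral ℤ α₂ := hint τ
  have i3 : IsIntegral ℤ α₃ := hint σ
  have i4 : IsIntegral ℤ α₄ := hint (τ * σ)
  have r1 := hα
  have r2 := hroot τ
  have r3 := hroot σ
  have r4 := hroot (τ * σ)
  rw [← hα₂] at r2
  rw [← hα₃] at r3
  rw [← hα₄] at r4
  have e12 : α ^ 3 + α ^ 2 * α₂ + α * α₂ ^ 2 + α₂ ^ 3 + a * (α ^ 2 + α * α₂ + α₂ ^ 2)
      + b * (α + α₂) + c = 0 := by
    apply mul_left_cancel₀ (sub_ne_zero.mpr n12)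
    linear_combination r1 - r2
  have e13 : α ^ 3 + α ^ 2 * α₃ + α * α₃ ^ 2 + α₃ ^ 3 + a * (α ^ 2 + α * α₃ + α₃ ^ 2)
      + b * (α + α₃) + c = 0 := by
    apply mul_left_cancel₀ (sub_ne_zero.mpr n13)
    linear_combination r1 - r3
  have e14 : α ^ 3 + α ^ 2 * α₄ + α * α₄ ^ 2 + α₄ ^ 3 + a * (α ^ 2 + α * α₄ + α₄ ^ 2)
      + b * (α + α₄) + c = 0 := by
    apply mul_left_cancel₀ (sub_ne_zero.mpr n14)
    linear_combination r1 - r4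
  have e23 : α ^ 2 + α₂ ^ 2 + α₃ ^ 2 + α * α₂ + α * α₃ + α₂ * α₃ + a * (α + α₂ + α₃) + b = 0 := by
    apply mul_left_cancel₀ (sub_ne_zero.mpr n23)
    linear_combination e12 - e13
  have e24 : α ^ 2 + α₂ ^ 2 + α₄ ^ 2 + α * α₂ + α * α₄ + α₂ * α₄ + a * (α + α₂ + α₄) + b = 0 := by
    apply mul_left_cancel₀ (sub_ne_zero.mpr n24)
    linear_combination e12 - e14
  have ha : (a : K) = -(α + α₂ + α₃ + α₄) := by
    apply mul_left_cancel₀ (sub_ne_zero.mpr n34)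
    linear_combination e23 - e24
  have hb : (b : K) = (α + α₂) * (α₃ + α₄) + α * α₂ + α₃ * α₄ := by
    linear_combination e23 - (α + α₂ + α₃) * ha
  have hc : (c : K) = -(α * α₂ * (α₃ + α₄) + α₃ * α₄ * (α + α₂)) := by
    linear_combination e12 - (α ^ 2 + α * α₂ + α₂ ^ 2) * ha - (α + α₂) * hb
  have hd : (d : K) = α * α₂ * (α₃ * α₄) := by
    linear_combination r1 - α ^ 3 * ha - α ^ 2 * hb - α * hc
  have hσ3 : σ α₃ = (σ * σ) α := rfl
  have hσ4 : σ α₄ = (τ * (σ * σ)) α := by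
    rw [hα₄, ← AlgEquiv.mul_apply, ← mul_assoc, hcomm, mul_assoc]
  have hxσ : σ (α * α₂ + α₃ * α₄) = α * α₂ + α₃ * α₄ := by
    rcases hσσ with h | h
    · rw [map_add, map_mul, map_mul, hσ₂, hσ3, hσ4, h, mul_one, AlgEquiv.one_apply, ← hα₃,
        ← hα₂]
      ring
    · rw [map_add, map_mul, map_mul, hσ₂, hσ3, hσ4, h, hττ, AlgEquiv.one_apply, ← hα₃, ← hα₂]
      ring
  obtain ⟨x, hx⟩ := hfix (α * α₂ + α₃ * α₄) ((i1.mul i2).add (i3.mul i4))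
    (by simp only [map_add, map_mul, hτ₂, hτ₃, hτ₄, ← hα₂]; ring) hxσ
  have hρ : ∃ y : ℤ, (y : K) = (α - α₂) * (α₃ - α₄) ∨
      (y : K) = (α + α₂ - α₃ - α₄) * ((α - α₂) * (α₃ - α₄)) := by
    rcases hσσ with h | h
    · obtain ⟨y, hy⟩ := hfix ((α - α₂) * (α₃ - α₄)) ((i1.sub i2).mul (i3.sub i4))
        (by simp only [map_sub, map_mul, hτ₂, hτ₃, hτ₄, ← hα₂]; ring)
        (by
          simp only [map_sub, map_mul, hσ₂, hσ3, hσ4, ← hα₃, h, mul_one, AlgEquiv.one_apply,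
            ← hα₂]
          ring)
      exact ⟨y, Or.inl hy⟩
    · obtain ⟨y, hy⟩ := hfix ((α + α₂ - α₃ - α₄) * ((α - α₂) * (α₃ - α₄)))
        ((((i1.add i2).sub i3).sub i4).mul ((i1.sub i2).mul (i3.sub i4)))
        (by simp only [map_sub, map_add, map_mul, hτ₂, hτ₃, hτ₄, ← hα₂]; ring)
        (by
          simp only [map_sub, map_add, map_mul, hσ₂, hσ3, hσ4, ← hα₃, h, hττ,
            AlgEquiv.one_apply, ← hα₂]
          ring)
      exact ⟨y, Or.inr hy⟩
  obtain ⟨y, hy⟩ := hρ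
  have hU : (a : K) ^ 2 - 4 * b + 4 * x = (α + α₂ - α₃ - α₄) ^ 2 := by
    rw [ha, hb, hx]; ring
  have hV : (x : K) ^ 2 - 4 * d = (α * α₂ - α₃ * α₄) ^ 2 := by
    rw [hd, hx]; ring
  have hN : ((b : K) - x) ^ 2 - 4 * a * c + 4 * (b - x) * x + 16 * d
      = ((α - α₂) * (α₃ - α₄)) ^ 2 := by
    rw [ha, hb, hc, hd, hx]; ring
  refine ⟨x, y, ?_, ?_, ?_⟩
  · have : (((a ^ 2 - 4 * b + 4 * x) * (x ^ 2 - 4 * d) : ℤ) : K)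
        = ((2 * c - a * x) ^ 2 : ℤ) := by
      push_cast
      rw [hU, hV, ha, hc, hx]
      ring
    exact_mod_cast this
  · rintro ⟨h1, h2⟩
    have h1' : (α + α₂ - α₃ - α₄) ^ 2 = 0 := by
      rw [← hU]
      exact_mod_cast congrArg (Int.cast : ℤ → K) h1
    have h2' : (α * α₂ - α₃ * α₄) ^ 2 = 0 := by
      rw [← hV]
      exact_mod_cast congrArg (Int.cast : ℤ → K) h2
    have h1'' := pow_eq_zero_iff (two_ne_zero) |>.mp h1'
    have h2'' := pow_eq_zero_iff (two_ne_zero) |>.mp h2'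
    have : (α - α₃) * (α - α₄) = 0 := by linear_combination α * h1'' - h2''
    rcases mul_eq_zero.mp this with h | h
    · exact n13 (sub_eq_zero.mp h)
    · exact n14 (sub_eq_zero.mp h)
  · rcases hy with hy | hy
    · left
      have : (((b - x) ^ 2 - 4 * a * c + 4 * (b - x) * x + 16 * d : ℤ) : K) = (y ^ 2 : ℤ) := by
        push_cast
        rw [hN, hy]
      exact_mod_cast this
    · right
      have : (((a ^ 2 - 4 * b + 4 * x) *
          ((b - x) ^ 2 - 4 * a * c + 4 * (b - x) * x + 16 * d) : ℤ) : K) = (y ^ 2 : ℤ) := by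
        push_cast
        rw [hU, hN, hy]
        ring
      exact_mod_cast this

open Polynomial in
theorem exists_isGalois_finrank_eq_card_gal.{u} {F : Type u} [Field F] {f : F[X]}
    (hirr : Irreducible f) (hsep : f.Separable) :
    ∃ (K : Type u) (_ : Field K) (_ : Algebra F K) (_ : FiniteDimensional F K) (_ : IsGalois F K),
      Module.finrank F K = Nat.card f.Gal ∧ ∃ α : K, aeval α f = 0 := by
  refine ⟨f.SplittingField, inferInstance, inferInstance, inferInstance,
    IsGalois.of_separable_splitting_field hsep, (Gal.card_of_separable hsep).symm, ?_⟩
  obtain ⟨α, hα⟩ := (SplittingField.splits f).exists_eval_eq_zero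
    (by rw [degree_map]; exact (degree_pos_of_irreducible hirr).ne')
  exact ⟨α, by rwa [eval_map_algebraMap] at hα⟩

open Polynomial in
/-- The resolvent data of an irreducible quartic whose Galois group has order four. -/
theorem exists_resolvent_root {a b c d : ℤ}
    (hirr : Irreducible (X ^ 4 + C (a : ℚ) * X ^ 3 + C (b : ℚ) * X ^ 2 + C (c : ℚ) * X
        + C (d : ℚ)))
    (hcard : Nat.card (X ^ 4 + C (a : ℚ) * X ^ 3 + C (b : ℚ) * X ^ 2 + C (c : ℚ) * X
        + C (d : ℚ)).Gal = 4) :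
    ∃ x y : ℤ, (a ^ 2 - 4 * b + 4 * x) * (x ^ 2 - 4 * d) = (2 * c - a * x) ^ 2 ∧
      ¬(a ^ 2 - 4 * b + 4 * x = 0 ∧ x ^ 2 - 4 * d = 0) ∧
      ((b - x) ^ 2 - 4 * a * c + 4 * (b - x) * x + 16 * d = y ^ 2 ∨
        (a ^ 2 - 4 * b + 4 * x) * ((b - x) ^ 2 - 4 * a * c + 4 * (b - x) * x + 16 * d)
          = y ^ 2) := by
  set f : ℚ[X] := X ^ 4 + C (a : ℚ) * X ^ 3 + C (b : ℚ) * X ^ 2 + C (c : ℚ) * X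
        + C (d : ℚ) with hf
  obtain ⟨K, _, _, _, _, hfr, α, hα⟩ := exists_isGalois_finrank_eq_card_gal hirr hirr.separable
  refine exists_resolvent_root_of_finrank_eq_four (hfr.trans hcard) hirr (α := α) ?_
  simpa [hf] using hα

theorem card_conic_le {F : Type*} [Field F] [Fintype F] [DecidableEq F] (h2 : (2 : F) ≠ 0)
    {t n : F} (ht : t ≠ 0) (hn : n ≠ 0) :
    (Finset.univ.filter fun P : F × F => t * (P.1 ^ 2 - n) = P.2 ^ 2).card
      ≤ Fintype.card F + 2 := by
  set S := Finset.univ.filter fun P : F × F => t * (P.1 ^ 2 - n) = P.2 ^ 2 with hS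
  rcases S.eq_empty_or_nonempty with h | ⟨⟨z₀, y₀⟩, h₀⟩
  · simp [h]
  have e₀ : t * (z₀ ^ 2 - n) = y₀ ^ 2 := by simpa [hS] using h₀
  rw [← Finset.card_filter_add_card_filter_not (s := S) (fun P => P.1 = z₀), add_comm]
  refine add_le_add ?_ ?_
  · rw [← Finset.card_univ]
    refine Finset.card_le_card_of_injOn (fun P => (P.2 - y₀) / (P.1 - z₀))
      (fun _ _ => Finset.mem_univ _) ?_
    rintro ⟨z, y⟩ hz ⟨z', y'⟩ hz' hs
    simp only [hS, Finset.coe_filter, Finset.mem_filter, Finset.mem_univ, true_and,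
      Set.mem_ofPred_eq] at hz hz' hs
    have d1 : z - z₀ ≠ 0 := sub_ne_zero.mpr hz.2
    have d2 : z' - z₀ ≠ 0 := sub_ne_zero.mpr hz'.2
    obtain ⟨s, hs1⟩ : ∃ s, s = (y - y₀) / (z - z₀) := ⟨_, rfl⟩
    have hs2 : s = (y' - y₀) / (z' - z₀) := hs1.trans hs
    have f1 : y = y₀ + s * (z - z₀) := by rw [hs1]; field_simp; ring
    have f2 : y' = y₀ + s * (z' - z₀) := by rw [hs2]; field_simp; ring
    have g1 : t * (z + z₀) = s * (2 * y₀ + s * (z - z₀)) := by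
      apply mul_right_cancel₀ d1
      rw [f1] at hz
      linear_combination hz.1 - e₀
    have g2 : t * (z' + z₀) = s * (2 * y₀ + s * (z' - z₀)) := by
      apply mul_right_cancel₀ d2
      rw [f2] at hz'
      linear_combination hz'.1 - e₀
    have key : (t - s ^ 2) * (z - z') = 0 := by linear_combination g1 - g2
    have hts : t - s ^ 2 ≠ 0 := by
      intro hts
      have ht' : t = s ^ 2 := sub_eq_zero.mp hts
      have hs0 : s ≠ 0 := by
        rintro rfl
        exact ht (by simpa using ht')
      have h3 : y₀ = s * z₀ := by
        apply mul_left_cancel₀ (mul_ne_zero h2 hs0)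
        rw [ht'] at g1
        linear_combination -g1
      have h4 : t * n = 0 := by
        rw [h3, ht'] at e₀
        rw [ht']
        linear_combination -e₀
      exact (mul_ne_zero ht hn) h4
    have hzz : z = z' := sub_eq_zero.mp ((mul_eq_zero.mp key).resolve_left hts)
    rw [f1, f2, hzz]
  · refine (Finset.card_le_card (t := {(z₀, y₀), (z₀, -y₀)}) ?_).trans Finset.card_le_two
    rintro ⟨z, y⟩ hz
    simp only [hS, Finset.mem_filter, Finset.mem_univ, true_and] at hz
    obtain ⟨hz, rfl⟩ := hz
    have := hz.symm.trans e₀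
    rcases sq_eq_sq_iff_eq_or_eq_neg.mp this with rfl | rfl <;> simp

theorem two_mul_card_le_card_add_six {F : Type*} [Field F] [Fintype F] [DecidableEq F]
    (h2 : (2 : F) ≠ 0) {t n : F} (ht : t ≠ 0) (hn : n ≠ 0) :
    2 * (Finset.univ.filter fun z : F => ∃ y, t * (z ^ 2 - n) = y ^ 2).card
      ≤ Fintype.card F + 6 := by
  set S := Finset.univ.filter fun z : F => ∃ y, t * (z ^ 2 - n) = y ^ 2 with hS
  have h0 : (S.filter fun z => z ^ 2 = n).card ≤ 2 := by
    rcases (S.filter fun z => z ^ 2 = n).eq_empty_or_nonempty with h | ⟨z₀, h₀⟩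
    · simp [h]
    refine (Finset.card_le_card (t := {z₀, -z₀}) ?_).trans Finset.card_le_two
    intro z hz
    simp only [Finset.mem_filter] at hz h₀
    rcases sq_eq_sq_iff_eq_or_eq_neg.mp (hz.2.trans h₀.2.symm) with rfl | rfl <;> simp
  have hex : ∀ z : F, ∃ y : F, z ∈ S → t * (z ^ 2 - n) = y ^ 2 := by
    intro z
    by_cases hz : z ∈ S
    · obtain ⟨y, hy⟩ := (Finset.mem_filter.mp hz).2
      exact ⟨y, fun _ => hy⟩
    · exact ⟨0, fun h => absurd h hz⟩
  choose r hr using hex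
  have h1 : 2 * (S.filter fun z => ¬ z ^ 2 = n).card ≤ Fintype.card F + 2 := by
    refine le_trans ?_ (card_conic_le h2 ht hn)
    rw [two_mul]
    set S' := S.filter fun z => ¬ z ^ 2 = n with hS'
    have c1 : (S'.image fun z => (z, r z)).card = S'.card :=
      Finset.card_image_of_injective _ fun a b h => (Prod.ext_iff.mp h).1
    have c2 : (S'.image fun z => (z, -r z)).card = S'.card :=
      Finset.card_image_of_injective _ fun a b h => (Prod.ext_iff.mp h).1
    nth_rewrite 1 [← c1]
    rw [← c2, ← Finset.card_union_of_disjoint]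
    · apply Finset.card_le_card
      intro P hP
      simp only [Finset.mem_union, Finset.mem_image, hS', Finset.mem_filter] at hP
      rcases hP with ⟨z, hz, rfl⟩ | ⟨z, hz, rfl⟩
      · simpa using hr z hz.1
      · simpa using hr z hz.1
    · rw [Finset.disjoint_left]
      intro P hP hP'
      simp only [Finset.mem_image, hS', Finset.mem_filter] at hP hP'
      obtain ⟨z, hz, rfl⟩ := hP
      obtain ⟨z', hz', h⟩ := hP'
      obtain ⟨rfl, h⟩ := Prod.ext_iff.mp h
      simp only at h
      have hr0 : r z' = 0 := by
        apply (mul_eq_zero.mp (_ : 2 * r z' = 0)).resolve_left h2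
        linear_combination -h
      have := hr z' hz.1
      rw [hr0] at this
      have h5 : z' ^ 2 - n = 0 := by
        apply (mul_eq_zero.mp (_ : t * (z' ^ 2 - n) = 0)).resolve_left ht
        rw [this]; ring
      exact hz.2 (sub_eq_zero.mp h5)
  have := Finset.card_filter_add_card_filter_not (s := S) (fun z => z ^ 2 = n)
  omega

open Classical in
/-- The residue pairs `(a, x)` modulo `p` at which `t` times the resolvent norm of the quartic
with data `(u, v, w, a, x)` is a square. -/
def normSquareResidues (p : ℕ) [NeZero p] (t u v w : ℤ) : Finset (ZMod p × ZMod p) :=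
  Finset.univ.filter fun P => ∃ y : ZMod p,
    (t : ZMod p) * ((P.1 ^ 2 + u * w ^ 2 - 8 * P.2) ^ 2 - 4 * u * (P.1 * w - 4 * v) ^ 2) = y ^ 2

theorem four_mul_card_normSquareResidues_le (p : ℕ) [NeZero p] (hp : p.Prime) (hp' : 16 ≤ p)
    {t u w : ℤ} (v : ℤ) (ht : ¬ (p : ℤ) ∣ t) (hu : ¬ (p : ℤ) ∣ u) (hw : ¬ (p : ℤ) ∣ w) :
    4 * (normSquareResidues p t u v w).card ≤ 3 * p ^ 2 := by
  classical
  have : Fact p.Prime := ⟨hp⟩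
  have cast_ne : ∀ {m : ℤ}, ¬ (p : ℤ) ∣ m → (m : ZMod p) ≠ 0 := fun h h' =>
    h ((ZMod.intCast_zmod_eq_zero_iff_dvd _ _).mp h')
  have h2 : (2 : ZMod p) ≠ 0 := by
    have := cast_ne (m := 2) (fun h => by
      have := Int.le_of_dvd (by norm_num) h
      omega)
    exact_mod_cast this
  have ht := cast_ne ht
  have hu := cast_ne hu
  have hw := cast_ne hw
  have h8 : (8 : ZMod p) ≠ 0 := by
    have : (8 : ZMod p) = 2 ^ 3 := by norm_num
    rw [this]
    exact pow_ne_zero _ h2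
  have h4 : (4 : ZMod p) ≠ 0 := by
    have : (4 : ZMod p) = 2 ^ 2 := by norm_num
    rw [this]
    exact pow_ne_zero _ h2
  have hfib : ∀ α : ZMod p, α * w - 4 * v ≠ 0 →
      2 * ((normSquareResidues p t u v w).filter fun P => P.1 = α).card ≤ p + 6 := by
    intro α hα
    have := two_mul_card_le_card_add_six h2 ht
      (n := 4 * u * (α * w - 4 * v) ^ 2) (mul_ne_zero (mul_ne_zero h4 hu) (pow_ne_zero _ hα))
    rw [ZMod.card] at this
    refine le_trans (Nat.mul_le_mul_left 2 ?_) this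
    refine Finset.card_le_card_of_injOn (fun P => α ^ 2 + u * w ^ 2 - 8 * P.2) ?_ ?_
    · rintro ⟨a, x⟩ h
      simp only [normSquareResidues, Finset.coe_filter, Finset.mem_filter, Finset.mem_univ,
        true_and, Set.mem_ofPred_eq] at h ⊢
      obtain ⟨h, rfl⟩ := h
      exact h
    · rintro ⟨a, x⟩ h ⟨a', x'⟩ h' e
      simp only [Finset.coe_filter, Set.mem_ofPred_eq] at h h' e
      have : x = x' := by
        apply mul_left_cancel₀ h8
        linear_combination -e
      rw [h.2, h'.2, this]
  have hfib' : ∀ α : ZMod p,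
      ((normSquareResidues p t u v w).filter fun P => P.1 = α).card ≤ p := by
    intro α
    have hc : (Finset.univ : Finset (ZMod p)).card = p := by rw [Finset.card_univ, ZMod.card]
    refine (Finset.card_le_card_of_injOn Prod.snd (fun _ _ => Finset.mem_univ _) ?_).trans hc.le
    rintro ⟨a, x⟩ h ⟨a', x'⟩ h' e
    simp only [Finset.coe_filter, Set.mem_ofPred_eq] at h h' e
    rw [h.2, h'.2, e]
  have hsum : 2 * (normSquareResidues p t u v w).card ≤ p * (p + 6) + 2 * p := by
    rw [Finset.card_eq_sum_card_fiberwise (f := Prod.fst) (t := Finset.univ)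
      (fun _ _ => Finset.mem_univ _), Finset.mul_sum,
      ← Finset.sum_erase_add _ _ (Finset.mem_univ (4 * (v : ZMod p) / w))]
    refine add_le_add ?_ (Nat.mul_le_mul_left 2 (hfib' _))
    refine (Finset.sum_le_card_nsmul _ _ (p + 6) ?_).trans ?_
    · intro α hα
      apply hfib
      intro h
      apply Finset.ne_of_mem_erase hα
      field_simp
      linear_combination h
    · rw [smul_eq_mul]
      refine Nat.mul_le_mul_right _ ((Finset.card_erase_le).trans ?_)
      rw [Finset.card_univ, ZMod.card]
  nlinarith

theorem abs_resolvent_root_le {N a b c d x : ℤ} (hN : 2 ≤ N) (ha : |a| ≤ N) (hb : |b| ≤ N)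
    (hc : |c| ≤ N) (hd : |d| ≤ N)
    (h : (a ^ 2 - 4 * b + 4 * x) * (x ^ 2 - 4 * d) = (2 * c - a * x) ^ 2) : |x| ≤ 3 * N := by
  by_contra! hx
  have e : x ^ 3 = b * x ^ 2 - (a * c - 4 * d) * x + (a ^ 2 * d - 4 * b * d + c ^ 2) := by
    linarith
  have n0 : (0 : ℤ) ≤ N := by omega
  have h1 : |b * x ^ 2| ≤ N * |x| ^ 2 := by
    rw [abs_mul, abs_pow]; gcongr
  have h2 : |(a * c - 4 * d) * x| ≤ (N * N + 4 * N) * |x| := by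
    rw [abs_mul]
    gcongr
    calc |a * c - 4 * d| ≤ |a * c| + |4 * d| := abs_sub _ _
      _ = |a| * |c| + 4 * |d| := by rw [abs_mul, abs_mul]; norm_num
      _ ≤ _ := by gcongr
  have h3 : |a ^ 2 * d - 4 * b * d + c ^ 2| ≤ N ^ 2 * N + 4 * N * N + N ^ 2 := by
    calc |a ^ 2 * d - 4 * b * d + c ^ 2| ≤ |a ^ 2 * d| + |4 * b * d| + |c ^ 2| :=
          (abs_add_le _ _).trans (add_le_add_left (abs_sub _ _) _)
      _ = |a| ^ 2 * |d| + 4 * |b| * |d| + |c| ^ 2 := by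
          simp only [abs_mul, abs_pow]; norm_num
      _ ≤ _ := by gcongr
  have h4 : |x| ^ 3 ≤ N * |x| ^ 2 + (N * N + 4 * N) * |x| + (N ^ 2 * N + 4 * N * N + N ^ 2) := by
    rw [← abs_pow, e]
    refine (abs_add_le _ _).trans (add_le_add ((abs_sub _ _).trans (add_le_add h1 h2)) h3)
  generalize |x| = X at *
  obtain ⟨z, rfl⟩ : ∃ z, X = 3 * N + z := ⟨X - 3 * N, by ring⟩
  have hz : 0 < z := by linarith
  obtain ⟨n, rfl⟩ : ∃ n, N = 2 + n := ⟨N - 2, by ring⟩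
  have hn : 0 ≤ n := by linarith
  have : 0 < (3 * (2 + n) + z) ^ 3 - ((2 + n) * (3 * (2 + n) + z) ^ 2 +
      ((2 + n) * (2 + n) + 4 * (2 + n)) * (3 * (2 + n) + z) +
      ((2 + n) ^ 2 * (2 + n) + 4 * (2 + n) * (2 + n) + (2 + n) ^ 2)) := by
    ring_nf
    positivity
  linarith

theorem exists_common_squareclass {U V k : ℤ} (hU : U ≠ 0) (hV : V ≠ 0) (h : U * V = k ^ 2) :
    ∃ u v w : ℤ, u ≠ 0 ∧ v ≠ 0 ∧ w ≠ 0 ∧ U = u * w ^ 2 ∧ V = u * v ^ 2 ∧ u * v * w = k := by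
  have hG : 0 < Int.gcd U V := Int.gcd_pos_of_ne_zero_left _ hU
  obtain ⟨U', V', hc, eU, eV⟩ := Int.exists_gcd_one hG
  set G : ℤ := (Int.gcd U V : ℤ) with hGdef
  have hG0 : G ≠ 0 := by positivity
  have hk : G ∣ k := by
    rw [← Int.pow_dvd_pow_iff (n := 2) (by norm_num), ← h]
    exact ⟨U' * V', by rw [eU, eV]; ring⟩
  obtain ⟨k', rfl⟩ := hk
  have h' : U' * V' = k' ^ 2 := by
    apply mul_left_cancel₀ (pow_ne_zero 2 hG0)
    rw [eU, eV] at h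
    linear_combination h
  have hc' : IsCoprime U' V' := Int.isCoprime_iff_gcd_eq_one.mpr hc
  obtain ⟨w, hw⟩ := Int.sq_of_isCoprime hc' h'
  obtain ⟨v, hv⟩ := Int.sq_of_isCoprime hc'.symm ((mul_comm _ _).trans h')
  have hU' : U' ≠ 0 := by rintro rfl; simp [eU] at hU
  have hV' : V' ≠ 0 := by rintro rfl; simp [eV] at hV
  have hw0 : w ≠ 0 := by rintro rfl; simp at hw; exact hU' hw
  have hv0 : v ≠ 0 := by rintro rfl; simp at hv; exact hV' hv
  have key : ∃ s : ℤ, (s = 1 ∨ s = -1) ∧ U' = s * w ^ 2 ∧ V' = s * v ^ 2 := by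
    have hnn : 0 ≤ U' * V' := by rw [h']; positivity
    have pw : 0 < w ^ 2 := by positivity
    have pv : 0 < v ^ 2 := by positivity
    rcases hw with hw | hw <;> rcases hv with hv | hv
    · exact ⟨1, Or.inl rfl, by simpa using hw, by simpa using hv⟩
    · rw [hw, hv] at hnn; nlinarith [mul_pos pw pv]
    · rw [hw, hv] at hnn; nlinarith [mul_pos pw pv]
    · exact ⟨-1, Or.inr rfl, by simpa using hw, by simpa using hv⟩
  obtain ⟨s, hs, eU', eV'⟩ := key
  have hss : s * s = 1 := by rcases hs with rfl | rfl <;> norm_num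
  have hs0 : s ≠ 0 := by rintro rfl; simp at hss
  have hsq : (s * v * w) ^ 2 = k' ^ 2 := by
    rw [← h', eU', eV']; ring
  have hu : G * s ≠ 0 := mul_ne_zero hG0 hs0
  rcases sq_eq_sq_iff_eq_or_eq_neg.mp hsq with e | e
  · exact ⟨G * s, v, w, hu, hv0, hw0, by rw [eU, eU']; ring, by rw [eV, eV']; ring,
      by rw [← e]; ring⟩
  · exact ⟨G * s, -v, w, hu, neg_ne_zero.mpr hv0, hw0, by rw [eU, eU']; ring,
      by rw [eV, eV']; ring, by linear_combination -G * e⟩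

theorem real_box_neg {N a b d x g v w T : ℝ} (hN : 1 ≤ N) (hb : |b| ≤ N)
    (hd : |d| ≤ N) (hx : |x| ≤ 3 * N)
    (eb : a ^ 2 - 4 * b + 4 * x = -(g ^ 2 * w ^ 2)) (ed : x ^ 2 - 4 * d = -(g ^ 2 * v ^ 2))
    (hT0 : 0 ≤ T) (hT : T ^ 2 = g ^ 2 * v ^ 2 ∨ T ^ 2 = g ^ 2 * w ^ 2) :
    |a| * T ≤ 16 * N ∧ |x| * T ≤ 16 * N ∧ T ≤ 32 * N := by
  have b1 := abs_le.mp hb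
  have d1 := abs_le.mp hd
  have x1 := abs_le.mp hx
  have gv : 0 ≤ g ^ 2 * v ^ 2 := by positivity
  have gw : 0 ≤ g ^ 2 * w ^ 2 := by positivity
  have hT2 : T ^ 2 ≤ 16 * N := by
    rcases hT with h | h <;> nlinarith [sq_nonneg x, sq_nonneg a]
  have ha2 : |a| ^ 2 ≤ 16 * N := by rw [sq_abs]; nlinarith
  have hx2 : |x| ^ 2 ≤ 16 * N := by rw [sq_abs]; nlinarith
  refine ⟨?_, ?_, ?_⟩
  · nlinarith [sq_nonneg (|a| - T)]
  · nlinarith [sq_nonneg (|x| - T)]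
  · nlinarith

theorem abs_le_of_add_le_of_mul_le {N r s : ℝ} (hN : 0 ≤ N) (h : |r + s| ≤ 4 * N)
    (h' : |r * s| ≤ 64 * N ^ 2) : |r| ≤ 16 * N := by
  by_contra! hr
  have h1 : r ^ 2 = (r + s) * r - r * s := by ring
  have h2 : |r| ^ 2 ≤ 4 * N * |r| + 64 * N ^ 2 := by
    rw [← abs_pow, h1]
    refine (abs_sub _ _).trans (add_le_add ?_ h')
    rw [abs_mul]
    gcongr
  nlinarith

theorem real_box_pos {N a b c d x g v w T : ℝ} (hN : 1 ≤ N) (ha : |a| ≤ N) (hb : |b| ≤ N)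
    (hc : |c| ≤ N) (hd : |d| ≤ N) (hx : |x| ≤ 3 * N) (hg : 0 ≤ g)
    (eb : a ^ 2 - 4 * b + 4 * x = g ^ 2 * w ^ 2) (ed : x ^ 2 - 4 * d = g ^ 2 * v ^ 2)
    (ec : a * x - 2 * c = g ^ 2 * v * w) (hT : T = g * max |v| |w|) :
    ((|a - g * w| * T ≤ 16 * N ∧ |x - g * v| * T ≤ 16 * N) ∨
      (|a + g * w| * T ≤ 16 * N ∧ |x + g * v| * T ≤ 16 * N)) ∧ T ≤ 32 * N := by
  have b1 := abs_le.mp hb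
  have d1 := abs_le.mp hd
  have x1 := abs_le.mp hx
  have a1 := abs_le.mp ha
  have c1 := abs_le.mp hc
  have hPP : |(x + g * v) * (x - g * v)| ≤ 4 * N := by
    have : (x + g * v) * (x - g * v) = 4 * d := by linear_combination ed
    rw [this, abs_le]; constructor <;> linarith
  have hQQ : |(a + g * w) * (a - g * w)| ≤ 16 * N := by
    have : (a + g * w) * (a - g * w) = 4 * (b - x) := by linear_combination eb
    rw [this, abs_le]; constructor <;> linarith
  have hsum : |(x + g * v) * (a - g * w) + (x - g * v) * (a + g * w)| ≤ 4 * N := by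
    have : (x + g * v) * (a - g * w) + (x - g * v) * (a + g * w) = 4 * c := by
      linear_combination 2 * ec
    rw [this, abs_le]; constructor <;> linarith
  have hprod : |(x + g * v) * (a - g * w) * ((x - g * v) * (a + g * w))| ≤ 64 * N ^ 2 := by
    have : (x + g * v) * (a - g * w) * ((x - g * v) * (a + g * w)) =
      ((x + g * v) * (x - g * v)) * ((a + g * w) * (a - g * w)) := by ring
    rw [this, abs_mul]
    refine (mul_le_mul hPP hQQ (abs_nonneg _) (by linarith)).trans (le_of_eq (by ring))
  have hPQ' := abs_le_of_add_le_of_mul_le (by linarith) hsum hprod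
  have hP'Q := abs_le_of_add_le_of_mul_le (by linarith) (by rwa [add_comm])
    (by rwa [mul_comm] : |(x - g * v) * (a + g * w) * ((x + g * v) * (a - g * w))| ≤ 64 * N ^ 2)
  have hPP16 : |(x + g * v) * (x - g * v)| ≤ 16 * N := by linarith
  have hTm : T ≤ max (max |x + g * v| |a + g * w|) (max |x - g * v| |a - g * w|) := by
    have key : ∀ y z : ℝ, 0 ≤ g → g * |z| ≤ max |y + g * z| |y - g * z| := by
      intro y z hg
      have : g * |z| = |g * z| := by rw [abs_mul, abs_of_nonneg hg]
      rw [this]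
      have h1 : 2 * |g * z| ≤ |y + g * z| + |y - g * z| := by
        have := abs_sub (y + g * z) (y - g * z)
        rw [show y + g * z - (y - g * z) = 2 * (g * z) by ring, abs_mul, abs_two] at this
        exact this
      rcases le_total |y + g * z| |y - g * z| with h | h
      · rw [max_eq_right h]; linarith
      · rw [max_eq_left h]; linarith
    rw [hT, mul_max_of_nonneg _ _ hg, max_max_max_comm]
    exact max_le_max (key x v hg) (key a w hg)
  refine ⟨?_, ?_⟩
  · rw [abs_mul] at hPQ' hP'Q hPP16 hQQ
    rcases le_max_iff.mp hTm with h | h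
    · left
      rcases le_max_iff.mp h with h | h
      · exact ⟨(mul_le_mul_of_nonneg_left h (abs_nonneg _)).trans (by linarith),
          (mul_le_mul_of_nonneg_left h (abs_nonneg _)).trans (by linarith)⟩
      · exact ⟨(mul_le_mul_of_nonneg_left h (abs_nonneg _)).trans (by linarith),
          (mul_le_mul_of_nonneg_left h (abs_nonneg _)).trans (by linarith)⟩
    · right
      rcases le_max_iff.mp h with h | h
      · exact ⟨(mul_le_mul_of_nonneg_left h (abs_nonneg _)).trans (by linarith),
          (mul_le_mul_of_nonneg_left h (abs_nonneg _)).trans (by linarith)⟩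
      · exact ⟨(mul_le_mul_of_nonneg_left h (abs_nonneg _)).trans (by linarith),
          (mul_le_mul_of_nonneg_left h (abs_nonneg _)).trans (by linarith)⟩
  · have hv : g * |v| ≤ 32 * N := by
      apply abs_le_of_sq_le_sq' _ (by linarith) |>.2
      rw [mul_pow, sq_abs, ← ed]; nlinarith
    have hw : g * |w| ≤ 32 * N := by
      apply abs_le_of_sq_le_sq' _ (by linarith) |>.2
      rw [mul_pow, sq_abs, ← eb]; nlinarith
    rw [hT, mul_max_of_nonneg _ _ hg]
    exact max_le hv hw

/-- The lower corner in one coordinate of the square box of scale `i` attached to `(u, m)`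
and the sign `ε`. -/
noncomputable def boxCorner (i : ℕ) (ε u m : ℤ) : ℤ :=
  ⌊(ε : ℝ) * (√|(u : ℝ)| * m)⌋ - 2 ^ i

theorem mem_Ico_boxCorner {i : ℕ} {ε u m a : ℤ}
    (h : |(a : ℝ) - ε * (√|(u : ℝ)| * m)| < 2 ^ i) :
    a ∈ Finset.Ico (boxCorner i ε u m) (boxCorner i ε u m + 2 ^ (i + 2)) := by
  unfold boxCorner
  set y : ℝ := ε * (√|(u : ℝ)| * m)
  have h1 := abs_lt.mp h
  have f1 := Int.floor_le y
  have f2 := Int.lt_floor_add_one y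
  have p1 : (1 : ℝ) ≤ 2 ^ i := one_le_pow₀ (by norm_num)
  rw [Finset.mem_Ico]
  constructor
  · have : ((⌊y⌋ - 2 ^ i : ℤ) : ℝ) ≤ a := by push_cast; linarith
    exact_mod_cast this
  · have : (a : ℝ) < ((⌊y⌋ - 2 ^ i + 2 ^ (i + 2) : ℤ) : ℝ) := by
      push_cast
      rw [pow_add]
      linarith
    exact_mod_cast this

theorem exists_real_box {N : ℕ} (hN : 2 ≤ N) {a b c d x u v w : ℤ} (ha : |a| ≤ N) (hb : |b| ≤ N)
    (hc : |c| ≤ N) (hd : |d| ≤ N) (hx : |x| ≤ 3 * N)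
    (eb : a ^ 2 - 4 * b + 4 * x = u * w ^ 2) (ed : x ^ 2 - 4 * d = u * v ^ 2)
    (ec : a * x - 2 * c = u * v * w) :
    ∃ T : ℝ, T = √|(u : ℝ)| * max |(v : ℝ)| |(w : ℝ)| ∧ T ≤ 32 * N ∧
      ∃ ε : ℤ, ε ∈ ({-1, 0, 1} : Finset ℤ) ∧
        |(a : ℝ) - ε * (√|(u : ℝ)| * w)| * T ≤ 16 * N ∧
        |(x : ℝ) - ε * (√|(u : ℝ)| * v)| * T ≤ 16 * N := by
  refine ⟨_, rfl, ?_⟩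
  set g := √|(u : ℝ)| with hgdef
  have hg : 0 ≤ g := Real.sqrt_nonneg _
  have hg2 : g ^ 2 = |(u : ℝ)| := Real.sq_sqrt (abs_nonneg _)
  have ha' : |(a : ℝ)| ≤ N := by exact_mod_cast ha
  have hb' : |(b : ℝ)| ≤ N := by exact_mod_cast hb
  have hc' : |(c : ℝ)| ≤ N := by exact_mod_cast hc
  have hd' : |(d : ℝ)| ≤ N := by exact_mod_cast hd
  have hx' : |(x : ℝ)| ≤ 3 * N := by exact_mod_cast hx
  have hN' : (1 : ℝ) ≤ N := by exact_mod_cast (by omega : 1 ≤ N)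
  have eb' : (a : ℝ) ^ 2 - 4 * b + 4 * x = u * w ^ 2 := by exact_mod_cast eb
  have ed' : (x : ℝ) ^ 2 - 4 * d = u * v ^ 2 := by exact_mod_cast ed
  have ec' : (a : ℝ) * x - 2 * c = u * v * w := by exact_mod_cast ec
  rcases le_total 0 (u : ℝ) with hu | hu
  · rw [abs_of_nonneg hu] at hg2
    rw [← hg2] at eb' ed' ec'
    obtain ⟨h, hT⟩ := real_box_pos hN' ha' hb' hc' hd' hx' hg eb' ed' ec' rfl
    refine ⟨hT, ?_⟩
    rcases h with h | h
    · exact ⟨1, by simp, by simpa using h⟩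
    · exact ⟨-1, by simp, by simpa using h⟩
  · rw [abs_of_nonpos hu] at hg2
    rw [show (u : ℝ) = -g ^ 2 by linarith] at eb' ed'
    have := real_box_neg (a := a) (g := g) (v := v) (w := w)
      (T := g * max |(v : ℝ)| |(w : ℝ)|) hN' hb' hd' hx'
      (by linarith) (by linarith) (by positivity) (by
        rcases max_choice |(v : ℝ)| |(w : ℝ)| with h | h
        · left; rw [h, mul_pow, sq_abs]
        · right; rw [h, mul_pow, sq_abs])
    exact ⟨this.2.2, 0, by simp, by simpa using ⟨this.1, this.2.1⟩⟩

theorem exists_dyadic_box {N : ℕ} (hN : 2 ≤ N) {a b c d x u v w : ℤ} (hu : u ≠ 0) (hv : v ≠ 0)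
    (ha : |a| ≤ N) (hb : |b| ≤ N)
    (hc : |c| ≤ N) (hd : |d| ≤ N) (hx : |x| ≤ 3 * N)
    (eb : a ^ 2 - 4 * b + 4 * x = u * w ^ 2) (ed : x ^ 2 - 4 * d = u * v ^ 2)
    (ec : a * x - 2 * c = u * v * w) :
    ∃ i < 32 * N, 4 ^ i * (|u| * v ^ 2) ≤ (32 * N) ^ 2 ∧ 4 ^ i * (|u| * w ^ 2) ≤ (32 * N) ^ 2 ∧
      ∃ ε : ℤ, ε ∈ ({-1, 0, 1} : Finset ℤ) ∧
        a ∈ Finset.Ico (boxCorner i ε u w) (boxCorner i ε u w + 2 ^ (i + 2)) ∧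
        x ∈ Finset.Ico (boxCorner i ε u v) (boxCorner i ε u v + 2 ^ (i + 2)) := by
  obtain ⟨T, hT, hTN, ε, hε, h1, h2⟩ := exists_real_box hN ha hb hc hd hx eb ed ec
  have hN' : (2 : ℝ) ≤ N := by exact_mod_cast hN
  have hu1 : (1 : ℝ) ≤ |(u : ℝ)| := by exact_mod_cast Int.one_le_abs hu
  have hv1 : (1 : ℝ) ≤ |(v : ℝ)| := by exact_mod_cast Int.one_le_abs hv
  have hg1 : 1 ≤ √|(u : ℝ)| := Real.one_le_sqrt.mpr hu1
  have hTv : √|(u : ℝ)| * |(v : ℝ)| ≤ T := by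
    rw [hT]; gcongr; exact le_max_left _ _
  have hTw : √|(u : ℝ)| * |(w : ℝ)| ≤ T := by
    rw [hT]; gcongr; exact le_max_right _ _
  have hT1 : 1 ≤ T := by nlinarith
  have hg2 : √|(u : ℝ)| ^ 2 = |(u : ℝ)| := Real.sq_sqrt (abs_nonneg _)
  obtain ⟨i, hi1, hi2⟩ := exists_nat_pow_near (x := 32 * N / T) (y := 2)
    ((one_le_div (by linarith)).mpr hTN) (by norm_num)
  rw [le_div_iff₀ (by linarith)] at hi1
  rw [div_lt_iff₀ (by linarith), pow_succ] at hi2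
  have hsq : (2 ^ i * T) ^ 2 ≤ (32 * N) ^ 2 := by gcongr
  have hbd : ∀ m : ℤ, √|(u : ℝ)| * |(m : ℝ)| ≤ T → 4 ^ i * (|u| * m ^ 2) ≤ (32 * N : ℤ) ^ 2 := by
    intro m hm
    have : (4 : ℝ) ^ i * (|(u : ℝ)| * (m : ℝ) ^ 2) ≤ (32 * N) ^ 2 := by
      refine le_trans ?_ hsq
      rw [mul_pow, ← pow_mul, mul_comm i 2, pow_mul, show (2 : ℝ) ^ 2 = 4 by norm_num, ← hg2,
        ← sq_abs (m : ℝ), ← mul_pow]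
      gcongr
    exact_mod_cast this
  refine ⟨i, ?_, hbd v hTv, hbd w hTw, ε, hε, mem_Ico_boxCorner ?_, mem_Ico_boxCorner ?_⟩
  · have h3 : (i : ℝ) < 2 ^ i := by exact_mod_cast Nat.lt_two_pow_self
    have h4 : (2 : ℝ) ^ i ≤ 2 ^ i * T := le_mul_of_one_le_right (by positivity) hT1
    have : (i : ℝ) < 32 * N := by linarith
    exact_mod_cast this
  · by_contra! h
    have := mul_le_mul_of_nonneg_right h (by linarith : 0 ≤ T)
    linarith
  · by_contra! h
    have := mul_le_mul_of_nonneg_right h (by linarith : 0 ≤ T)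
    linarith

theorem norm_eq_sixteen_mul_sq {a b c d x u v w : ℤ}
    (eb : a ^ 2 - 4 * b + 4 * x = u * w ^ 2) (ed : x ^ 2 - 4 * d = u * v ^ 2)
    (ec : a * x - 2 * c = u * v * w) :
    (a ^ 2 + u * w ^ 2 - 8 * x) ^ 2 - 4 * u * (a * w - 4 * v) ^ 2 =
      16 * ((b - x) ^ 2 - 4 * a * c + 4 * (b - x) * x + 16 * d) := by
  have h1 : u * w ^ 2 = a ^ 2 - 4 * b + 4 * x := eb.symm
  have h2 : u * v ^ 2 = x ^ 2 - 4 * d := ed.symm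
  have h3 : u * v * w = a * x - 2 * c := ec.symm
  have : (a ^ 2 + u * w ^ 2 - 8 * x) ^ 2 - 4 * u * (a * w - 4 * v) ^ 2 =
    (a ^ 2 + u * w ^ 2 - 8 * x) ^ 2 - 4 * a ^ 2 * (u * w ^ 2) + 32 * a * (u * v * w)
      - 64 * (u * v ^ 2) := by ring
  rw [this, h1, h2, h3]
  ring

theorem exists_parametrization {N : ℕ} (hN : 2 ≤ N) {a b c d x y : ℤ} (ha : |a| ≤ N)
    (hb : |b| ≤ N) (hc : |c| ≤ N) (hd : |d| ≤ N)
    (h : (a ^ 2 - 4 * b + 4 * x) * (x ^ 2 - 4 * d) = (2 * c - a * x) ^ 2)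
    (hU : a ^ 2 - 4 * b + 4 * x ≠ 0) (hV : x ^ 2 - 4 * d ≠ 0)
    (hy : (b - x) ^ 2 - 4 * a * c + 4 * (b - x) * x + 16 * d = y ^ 2 ∨
      (a ^ 2 - 4 * b + 4 * x) * ((b - x) ^ 2 - 4 * a * c + 4 * (b - x) * x + 16 * d) = y ^ 2) :
    ∃ u v w : ℤ, u ≠ 0 ∧ v ≠ 0 ∧ w ≠ 0 ∧
      a ^ 2 - 4 * b + 4 * x = u * w ^ 2 ∧ x ^ 2 - 4 * d = u * v ^ 2 ∧
      a * x - 2 * c = u * v * w ∧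
      (∃ t z : ℤ, (t = 1 ∨ t = u * w ^ 2) ∧
        t * ((a ^ 2 + u * w ^ 2 - 8 * x) ^ 2 - 4 * u * (a * w - 4 * v) ^ 2) = z ^ 2) ∧
      ∃ i < 32 * N, 4 ^ i * (|u| * v ^ 2) ≤ (32 * N) ^ 2 ∧ 4 ^ i * (|u| * w ^ 2) ≤ (32 * N) ^ 2 ∧
      ∃ ε : ℤ, ε ∈ ({-1, 0, 1} : Finset ℤ) ∧
        a ∈ Finset.Ico (boxCorner i ε u w) (boxCorner i ε u w + 2 ^ (i + 2)) ∧
        x ∈ Finset.Ico (boxCorner i ε u v) (boxCorner i ε u v + 2 ^ (i + 2)) := by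
  have hx := abs_resolvent_root_le (by exact_mod_cast hN) ha hb hc hd h
  obtain ⟨u, v, w, hu, hv, hw, eU, eV, ek⟩ := exists_common_squareclass hU hV
    (k := a * x - 2 * c) (by rw [h]; ring)
  refine ⟨u, v, w, hu, hv, hw, eU, eV, ek.symm, ?_,
    exists_dyadic_box hN hu hv ha hb hc hd hx eU eV ek.symm⟩
  rw [norm_eq_sixteen_mul_sq eU eV ek.symm]
  rcases hy with hy | hy
  · exact ⟨1, 4 * y, Or.inl rfl, by rw [hy]; ring⟩
  · exact ⟨u * w ^ 2, 4 * y, Or.inr rfl, by rw [← eU]; linear_combination 16 * hy⟩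

theorem card_box_le_of_residues {s : Finset ℕ} (hs : ∀ p ∈ s, p.Prime) {ℓ : ℕ} (α β : ℤ)
    (R : ∀ p : ℕ, Finset (ZMod p × ZMod p)) {B : Finset (ℤ × ℤ)}
    (hB : ∀ P ∈ B, P.1 ∈ Finset.Ico α (α + ℓ) ∧ P.2 ∈ Finset.Ico β (β + ℓ))
    (hR : ∀ P ∈ B, ∀ p ∈ s, ((P.1 : ZMod p), (P.2 : ZMod p)) ∈ R p) :
    B.card ≤ (ℓ / (∏ p ∈ s, p) + 1) ^ 2 * ∏ p ∈ s, (R p).card := by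
  classical
  set Q := ∏ p ∈ s, p with hQ
  have hQ0 : 0 < Q := Finset.prod_pos fun p hp => (hs p hp).pos
  have hcard : (((Finset.range (ℓ / Q + 1)) ×ˢ (Finset.range (ℓ / Q + 1))) ×ˢ s.pi R).card =
      (ℓ / Q + 1) ^ 2 * ∏ p ∈ s, (R p).card := by
    rw [Finset.card_product, Finset.card_product, Finset.card_pi, Finset.card_range, pow_two]
  rw [← hcard]
  have hlt : ∀ γ n : ℤ, n ∈ Finset.Ico γ (γ + ℓ) → (n - γ).toNat / Q < ℓ / Q + 1 := by
    intro γ n hn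
    rw [Finset.mem_Ico] at hn
    exact Nat.lt_succ_of_le (Nat.div_le_div_right (by omega))
  refine Finset.card_le_card_of_injOn
    (fun P => ((((P.1 - α).toNat / Q, (P.2 - β).toNat / Q)),
      fun p _ => ((P.1 : ZMod p), (P.2 : ZMod p)))) ?_ ?_
  · intro P hP
    have h := hB P hP
    simp only [Finset.coe_product, Set.mem_prod, Finset.mem_coe, Finset.mem_range,
      Finset.mem_pi]
    exact ⟨⟨hlt _ _ h.1, hlt _ _ h.2⟩, fun p hp => hR P hP p hp⟩
  · intro P hP P' hP' e
    have h := hB P hP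
    have h' := hB P' hP'
    simp only [Prod.mk.injEq] at e
    obtain ⟨⟨e1, e2⟩, e3⟩ := e
    have e3' : ∀ p ∈ s, ((P.1 : ZMod p), (P.2 : ZMod p)) = ((P'.1 : ZMod p), (P'.2 : ZMod p)) :=
      fun p hp => congrFun (congrFun e3 p) hp
    have key : ∀ γ n n' : ℤ, n ∈ Finset.Ico γ (γ + ℓ) → n' ∈ Finset.Ico γ (γ + ℓ) →
        (n - γ).toNat / Q = (n' - γ).toNat / Q → (∀ p ∈ s, (n : ZMod p) = (n' : ZMod p)) →
        n = n' := by
      intro γ n n' hn hn' hd hm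
      rw [Finset.mem_Ico] at hn hn'
      have hdvd : (Q : ℤ) ∣ n' - n := by
        rw [Int.natCast_dvd, hQ]
        refine Finset.prod_primes_dvd _ (fun p hp => (hs p hp).prime) fun p hp => ?_
        rw [← Int.natCast_dvd]
        exact (ZMod.intCast_eq_intCast_iff_dvd_sub _ _ _).mp (hm p hp)
      have hmod : (n - γ).toNat % Q = (n' - γ).toNat % Q := by
        have : (n - γ).toNat ≡ (n' - γ).toNat [MOD Q] := by
          rw [Nat.modEq_iff_dvd, Int.toNat_of_nonneg (by omega), Int.toNat_of_nonneg (by omega)]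
          convert hdvd using 1
          ring
        exact this
      have := Nat.div_add_mod (n - γ).toNat Q
      have := Nat.div_add_mod (n' - γ).toNat Q
      rw [hd, hmod] at *
      omega
    refine Prod.ext (key α _ _ h.1 h'.1 e1 fun p hp => (Prod.mk.inj (e3' p hp)).1)
      (key β _ _ h.2 h'.2 e2 fun p hp => (Prod.mk.inj (e3' p hp)).2)

open Classical in
/-- The pairs `(a, x)` in a square box of side `ℓ` for which `t` times the resolvent norm of the
data `(u, v, w, a, x)` is a square. -/
noncomputable def normSquareBox (ℓ : ℕ) (α β t u v w : ℤ) : Finset (ℤ × ℤ) :=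
  (Finset.Ico α (α + ℓ) ×ˢ Finset.Ico β (β + ℓ)).filter fun P => ∃ z : ℤ,
    t * ((P.1 ^ 2 + u * w ^ 2 - 8 * P.2) ^ 2 - 4 * u * (P.1 * w - 4 * v) ^ 2) = z ^ 2

theorem card_normSquareBox_le_sq (ℓ : ℕ) (α β t u v w : ℤ) :
    (normSquareBox ℓ α β t u v w).card ≤ ℓ ^ 2 := by
  classical
  refine (Finset.card_filter_le _ _).trans ?_
  rw [Finset.card_product, Int.card_Ico, Int.card_Ico, pow_two]
  simp

theorem card_normSquareBox_le {s : Finset ℕ} (hs : ∀ p ∈ s, p.Prime ∧ 16 ≤ p) {ℓ : ℕ}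
    (hℓ : ∏ p ∈ s, p ≤ ℓ) (α β v : ℤ) {t u w : ℤ} (hu : ∀ p ∈ s, ¬ (p : ℤ) ∣ u)
    (hw : ∀ p ∈ s, ¬ (p : ℤ) ∣ w) (ht : t = 1 ∨ t = u * w ^ 2) :
    ((normSquareBox ℓ α β t u v w).card : ℝ) ≤ 4 * ℓ ^ 2 * (3 / 4) ^ s.card := by
  classical
  have ht' : ∀ p ∈ s, ¬ (p : ℤ) ∣ t := by
    intro p hp h
    have hpp := Nat.prime_iff_prime_int.mp (hs p hp).1
    rcases ht with rfl | rfl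
    · exact hpp.not_dvd_one h
    · rcases hpp.dvd_or_dvd h with h | h
      · exact hu p hp h
      · exact hw p hp (hpp.dvd_of_dvd_pow h)
  let R : ∀ p : ℕ, Finset (ZMod p × ZMod p) := fun p =>
    if h : p = 0 then ∅ else haveI : NeZero p := ⟨h⟩; normSquareResidues p t u v w
  have hRdef : ∀ p (h : p ≠ 0), R p = haveI : NeZero p := ⟨h⟩; normSquareResidues p t u v w :=
    fun p h => dif_neg h
  have h1 : (normSquareBox ℓ α β t u v w).card ≤
      (ℓ / (∏ p ∈ s, p) + 1) ^ 2 * ∏ p ∈ s, (R p).card := by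
    refine card_box_le_of_residues (fun p hp => (hs p hp).1) α β R ?_ ?_
    · intro P hP
      exact Finset.mem_product.mp (Finset.mem_filter.mp hP).1
    · intro P hP p hp
      obtain ⟨z, hz⟩ := (Finset.mem_filter.mp hP).2
      have : NeZero p := ⟨(hs p hp).1.ne_zero⟩
      rw [hRdef p (hs p hp).1.ne_zero]
      refine Finset.mem_filter.mpr ⟨Finset.mem_univ _, z, ?_⟩
      have := congrArg (Int.cast : ℤ → ZMod p) hz
      push_cast at this
      exact this
  have h2 : ∏ p ∈ s, ((R p).card : ℝ) ≤ (3 / 4) ^ s.card * (∏ p ∈ s, (p : ℝ)) ^ 2 := by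
    rw [← Finset.prod_const, ← Finset.prod_pow, ← Finset.prod_mul_distrib]
    refine Finset.prod_le_prod (fun _ _ => by positivity) fun p hp => ?_
    have : NeZero p := ⟨(hs p hp).1.ne_zero⟩
    have h3 := four_mul_card_normSquareResidues_le p (hs p hp).1 (hs p hp).2 v (ht' p hp)
      (hu p hp) (hw p hp)
    rw [hRdef p (hs p hp).1.ne_zero]
    have h4 : (4 : ℝ) * (normSquareResidues p t u v w).card ≤ 3 * p ^ 2 := by exact_mod_cast h3
    linarith
  have hQ0 : 0 < ∏ p ∈ s, p := Finset.prod_pos fun p hp => (hs p hp).1.pos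
  set Q := ∏ p ∈ s, p with hQ
  have hQ' : ∏ p ∈ s, (p : ℝ) = Q := by rw [hQ]; push_cast; rfl
  have h5 : (ℓ / Q + 1) * Q ≤ 2 * ℓ := by
    have := Nat.div_mul_le_self ℓ Q
    rw [add_mul]
    omega
  have h6 : (((ℓ / Q : ℕ) : ℝ) + 1) * Q ≤ 2 * ℓ := by exact_mod_cast h5
  calc ((normSquareBox ℓ α β t u v w).card : ℝ)
      ≤ (((ℓ / Q : ℕ) : ℝ) + 1) ^ 2 * ∏ p ∈ s, ((R p).card : ℝ) := by exact_mod_cast h1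
    _ ≤ (((ℓ / Q : ℕ) : ℝ) + 1) ^ 2 * ((3 / 4) ^ s.card * Q ^ 2) := by
        rw [← hQ']; gcongr
    _ = ((((ℓ / Q : ℕ) : ℝ) + 1) * Q) ^ 2 * (3 / 4) ^ s.card := by ring
    _ ≤ (2 * ℓ) ^ 2 * (3 / 4) ^ s.card := by gcongr
    _ = _ := by ring

theorem card_normSquareBox_le_add {s : Finset ℕ} (hs : ∀ p ∈ s, p.Prime ∧ 16 ≤ p) {ℓ : ℕ}
    (hℓ : ∏ p ∈ s, p ≤ ℓ) (α β v : ℤ) {t u w : ℤ} (ht : t = 1 ∨ t = u * w ^ 2) :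
    ((normSquareBox ℓ α β t u v w).card : ℝ) ≤ ℓ ^ 2 * (4 * (3 / 4) ^ s.card +
      ∑ p ∈ s, ((if (p : ℤ) ∣ u then 1 else 0) + (if (p : ℤ) ∣ w then 1 else 0))) := by
  have hnn : ∀ q : ℕ, (0 : ℝ) ≤
      (if (q : ℤ) ∣ u then 1 else 0) + (if (q : ℤ) ∣ w then 1 else 0) := by
    intro q; positivity
  by_cases h : ∀ p ∈ s, ¬ (p : ℤ) ∣ u ∧ ¬ (p : ℤ) ∣ w
  · refine (card_normSquareBox_le hs hℓ α β v (fun p hp => (h p hp).1) (fun p hp => (h p hp).2)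
      ht).trans ?_
    have : (0 : ℝ) ≤ ℓ ^ 2 * ∑ p ∈ s,
      ((if (p : ℤ) ∣ u then 1 else 0) + (if (p : ℤ) ∣ w then 1 else 0)) :=
      mul_nonneg (by positivity) (Finset.sum_nonneg fun q _ => hnn q)
    linarith
  · push Not at h
    obtain ⟨p, hp, hpd⟩ := h
    have h1 : (1 : ℝ) ≤ ∑ p ∈ s,
        ((if (p : ℤ) ∣ u then 1 else 0) + (if (p : ℤ) ∣ w then 1 else 0)) := by
      refine le_trans ?_ (Finset.single_le_sum (fun q _ => hnn q) hp)
      by_cases hu : (p : ℤ) ∣ u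
      · rw [if_pos hu]
        split_ifs <;> norm_num
      · rw [if_neg hu, if_pos (hpd hu)]
        norm_num
    calc ((normSquareBox ℓ α β t u v w).card : ℝ) ≤ ℓ ^ 2 * 1 := by
          rw [mul_one]; exact_mod_cast card_normSquareBox_le_sq ℓ α β t u v w
      _ ≤ _ := by
          gcongr
          have : (0 : ℝ) ≤ 4 * (3 / 4) ^ s.card := by positivity
          linarith

theorem exists_sieving_primes (k : ℕ) : ∃ s : Finset ℕ, s.card = k ∧
    (∀ p ∈ s, p.Prime ∧ 16 ≤ p) ∧ ∏ p ∈ s, p ≤ 2 ^ (7 * k ^ 2) ∧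
    ∑ p ∈ s, (1 / p : ℝ) ≤ (3 / 4) ^ k := by
  have hB : ∀ j : ℕ, ∃ p : ℕ, p.Prime ∧ 2 ^ (2 * k + 4 + j) < p ∧ p ≤ 2 ^ (2 * k + 4 + j + 1) := by
    intro j
    obtain ⟨p, hp, h1, h2⟩ := Nat.exists_prime_lt_and_le_two_mul (2 ^ (2 * k + 4 + j)) (by positivity)
    exact ⟨p, hp, h1, by rw [pow_succ]; omega⟩
  choose q hq hlo hhi using hB
  have hmono : StrictMono q := strictMono_nat_of_lt_succ fun j => (hhi j).trans_lt (hlo (j + 1))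
  have hlo' : ∀ j, 16 * 4 ^ k ≤ q j := by
    intro j
    have h1 : 2 ^ (2 * k + 4) ≤ 2 ^ (2 * k + 4 + j) := Nat.pow_le_pow_right (by norm_num) (by omega)
    have h2 : 2 ^ (2 * k + 4) = 16 * 4 ^ k := by rw [pow_add, pow_mul]; norm_num; ring
    have := hlo j
    omega
  refine ⟨(Finset.range k).image q, ?_, ?_, ?_, ?_⟩
  · rw [Finset.card_image_of_injective _ hmono.injective, Finset.card_range]
  · intro p hp
    obtain ⟨j, -, rfl⟩ := Finset.mem_image.mp hp
    have := hlo' j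
    have : 0 < 4 ^ k := by positivity
    exact ⟨hq j, by omega⟩
  · rw [Finset.prod_image fun a _ b _ h => hmono.injective h]
    calc ∏ j ∈ Finset.range k, q j ≤ ∏ j ∈ Finset.range k, 2 ^ (2 * k + 4 + k) := by
          refine Finset.prod_le_prod' fun j hj => (hhi j).trans ?_
          have := Finset.mem_range.mp hj
          exact Nat.pow_le_pow_right (by norm_num) (by omega)
      _ = 2 ^ ((2 * k + 4 + k) * k) := by rw [Finset.prod_const, Finset.card_range, pow_mul]
      _ ≤ _ := by
          refine Nat.pow_le_pow_right (by norm_num) ?_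
          nlinarith [Nat.le_self_pow (n := 2) (by norm_num) k]
  · rw [Finset.sum_image fun a _ b _ h => hmono.injective h]
    calc ∑ j ∈ Finset.range k, (1 / (q j) : ℝ) ≤ ∑ j ∈ Finset.range k, (1 / (16 * 4 ^ k) : ℝ) := by
          refine Finset.sum_le_sum fun j _ => ?_
          gcongr
          exact_mod_cast hlo' j
      _ = k / (16 * 4 ^ k) := by rw [Finset.sum_const, Finset.card_range, nsmul_eq_mul]; ring
      _ ≤ 3 ^ k / 4 ^ k := by
          have h1 : (k : ℝ) ≤ 3 ^ k := by exact_mod_cast (Nat.lt_pow_self (by norm_num)).le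
          rw [div_le_div_iff₀ (by positivity) (by positivity)]
          have : (0 : ℝ) < 4 ^ k := by positivity
          have h3 : (0 : ℝ) < 3 ^ k := by positivity
          nlinarith [mul_pos this h3]
      _ = (3 / 4) ^ k := by rw [div_pow]

theorem exists_sieve_sets : ∃ s : ℕ → Finset ℕ, (∀ i, (s i).card = Nat.sqrt (i / 7)) ∧
    (∀ i, ∀ p ∈ s i, p.Prime ∧ 16 ≤ p) ∧ (∀ i, ∏ p ∈ s i, p ≤ 2 ^ i) ∧
    ∀ i, ∑ p ∈ s i, (1 / p : ℝ) ≤ (3 / 4) ^ Nat.sqrt (i / 7) := by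
  choose s h1 h2 h3 h4 using fun i : ℕ => exists_sieving_primes (Nat.sqrt (i / 7))
  refine ⟨s, h1, h2, fun i => (h3 i).trans (Nat.pow_le_pow_right (by norm_num) ?_), h4⟩
  have := Nat.sqrt_le' (i / 7)
  omega

theorem exists_sum_three_quarters_pow_le : ∃ C : ℝ, 0 < C ∧ ∀ n : ℕ,
    ∑ i ∈ Finset.range n, (3 / 4 : ℝ) ^ Nat.sqrt (i / 7) ≤ C := by
  have hs : Summable fun k : ℕ => ((k : ℝ) ^ 4 * (3 / 4) ^ k) :=
    summable_pow_mul_geometric_of_norm_lt_one 4 (by norm_num)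
  have hb : ∃ B : ℝ, 0 < B ∧ ∀ k : ℕ, ((k : ℝ) + 1) ^ 4 * (3 / 4) ^ k ≤ B := by
    obtain ⟨B, hB⟩ := (hs.tendsto_atTop_zero).bddAbove_range
    refine ⟨4 / 3 * max B 1, by positivity, fun k => ?_⟩
    have := hB ⟨k + 1, rfl⟩
    simp only at this
    push_cast at this
    rw [pow_succ (3 / 4 : ℝ)] at this
    have := le_max_left B 1
    linarith
  obtain ⟨B, hB0, hB⟩ := hb
  have hsum : Summable fun i : ℕ => 49 * B * (1 / ((i + 1 : ℕ) : ℝ) ^ 2) :=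
    ((summable_nat_add_iff 1).mpr (Real.summable_one_div_nat_pow.mpr one_lt_two)).mul_left _
  refine ⟨∑' i : ℕ, 49 * B * (1 / ((i + 1 : ℕ) : ℝ) ^ 2) + 1, ?_, fun n => ?_⟩
  · have : 0 ≤ ∑' i : ℕ, 49 * B * (1 / ((i + 1 : ℕ) : ℝ) ^ 2) := tsum_nonneg fun i => by positivity
    linarith
  · refine le_trans ?_ ((hsum.sum_le_tsum (Finset.range n) fun i _ => by positivity).trans
      (le_add_of_nonneg_right zero_le_one))
    refine Finset.sum_le_sum fun i _ => ?_
    set k := Nat.sqrt (i / 7) with hk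
    have h1 : i / 7 < (k + 1) ^ 2 := Nat.lt_succ_sqrt' _
    have h2 : i + 1 ≤ 7 * (k + 1) ^ 2 := by omega
    have h3 : (((i + 1 : ℕ) : ℝ)) ≤ 7 * ((k : ℝ) + 1) ^ 2 := by exact_mod_cast h2
    have h4 : (((i + 1 : ℕ) : ℝ)) ^ 2 ≤ 49 * ((k : ℝ) + 1) ^ 4 := by
      calc (((i + 1 : ℕ) : ℝ)) ^ 2 ≤ (7 * ((k : ℝ) + 1) ^ 2) ^ 2 := by gcongr
        _ = _ := by ring
    rw [mul_one_div, le_div_iff₀ (by positivity)]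
    calc (3 / 4 : ℝ) ^ k * ((i + 1 : ℕ) : ℝ) ^ 2 ≤ (3 / 4 : ℝ) ^ k * (49 * ((k : ℝ) + 1) ^ 4) := by
          gcongr
      _ = 49 * (((k : ℝ) + 1) ^ 4 * (3 / 4) ^ k) := by ring
      _ ≤ 49 * B := by gcongr; exact hB k

theorem card_nonzero_multiples_le {q : ℕ} (hq : 0 < q) {Y : ℝ} {S : Finset ℤ}
    (hS : ∀ m ∈ S, m ≠ 0 ∧ (q : ℤ) ∣ m ∧ (m : ℝ) ^ 2 ≤ Y) : (S.card : ℝ) ≤ 2 * √Y / q := by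
  classical
  set n := ⌊√Y / q⌋₊ with hn
  have hq' : (0 : ℝ) < q := by exact_mod_cast hq
  have hsub : S ⊆ ((Finset.Icc (-n : ℤ) n).erase 0).image fun k => (q : ℤ) * k := by
    intro m hm
    obtain ⟨h0, ⟨k, rfl⟩, hY⟩ := hS m hm
    refine Finset.mem_image.mpr ⟨k, ?_, rfl⟩
    have hk0 : k ≠ 0 := by rintro rfl; simp at h0
    rw [Finset.mem_erase, Finset.mem_Icc, ← abs_le]
    refine ⟨hk0, ?_⟩
    have h1 : |((q * k : ℤ) : ℝ)| ≤ √Y := Real.abs_le_sqrt hY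
    push_cast at h1
    rw [abs_mul, abs_of_pos hq'] at h1
    have h2 : ((k.natAbs : ℕ) : ℝ) ≤ √Y / q := by
      rw [le_div_iff₀ hq', Nat.cast_natAbs, Int.cast_abs]
      linarith
    rw [← Int.natCast_natAbs]
    exact_mod_cast Nat.le_floor h2
  have h1 : S.card ≤ 2 * n := by
    refine (Finset.card_le_card hsub).trans (Finset.card_image_le.trans ?_)
    rw [Finset.card_erase_of_mem (by simp), Int.card_Icc]
    omega
  have h2 : (n : ℝ) ≤ √Y / q := Nat.floor_le (by positivity)
  have h3 : (S.card : ℝ) ≤ 2 * n := by exact_mod_cast h1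
  rw [mul_div_assoc]
  linarith

theorem sum_one_div_abs_multiples_le {p M : ℕ} (hp : 0 < p) {S : Finset ℤ}
    (hS : ∀ m ∈ S, m ≠ 0 ∧ (p : ℤ) ∣ m ∧ |m| ≤ M) :
    ∑ m ∈ S, (1 / |(m : ℝ)|) ≤ 2 * (1 + Real.log M) / p := by
  classical
  have hp' : (0 : ℝ) < p := by exact_mod_cast hp
  have key : ∀ s : ℤ, (s = 1 ∨ s = -1) → ∀ S' : Finset ℤ,
      (∀ m ∈ S', 0 < s * m ∧ (p : ℤ) ∣ m ∧ |m| ≤ M) →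
      ∑ m ∈ S', (1 / |(m : ℝ)|) ≤ (1 + Real.log M) / p := by
    intro s hs S' hS'
    have hss : s * s = 1 := by rcases hs with rfl | rfl <;> norm_num
    have hs1 : |s| = 1 := by rcases hs with rfl | rfl <;> norm_num
    have hs1' : |(s : ℝ)| = 1 := by exact_mod_cast hs1
    have hs0 : s ≠ 0 := by rintro rfl; simp at hss
    have hinj : Function.Injective fun k : ℕ => s * ((p : ℤ) * k) := by
      intro k k' h
      have hp0 : (p : ℤ) ≠ 0 := by positivity
      have := mul_left_cancel₀ hp0 (mul_left_cancel₀ hs0 h)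
      exact_mod_cast this
    have hsub : S' ⊆ (Finset.Icc 1 M).image fun k : ℕ => s * ((p : ℤ) * k) := by
      intro m hm
      obtain ⟨h0, ⟨k, rfl⟩, hM⟩ := hS' m hm
      have hsk : 0 < s * k := by
        have : 0 < (p : ℤ) * (s * k) := by linarith
        exact (pos_iff_pos_of_mul_pos this).mp (by positivity)
      refine Finset.mem_image.mpr ⟨(s * k).toNat, ?_, ?_⟩
      · rw [Finset.mem_Icc]
        have h1 : |k| ≤ M := by
          refine le_trans ?_ hM
          rw [abs_mul]
          exact le_mul_of_one_le_left (abs_nonneg _)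
            (by rw [abs_of_nonneg (by positivity)]; exact_mod_cast hp)
        have h2 : s * k ≤ |k| := by
          calc s * k ≤ |s * k| := le_abs_self _
            _ = |k| := by rw [abs_mul, hs1, one_mul]
        omega
      · rw [Int.toNat_of_nonneg hsk.le]
        linear_combination (p : ℤ) * k * hss
    calc ∑ m ∈ S', (1 / |(m : ℝ)|)
        ≤ ∑ m ∈ (Finset.Icc 1 M).image fun k : ℕ => s * ((p : ℤ) * k), (1 / |(m : ℝ)|) :=
          Finset.sum_le_sum_of_subset_of_nonneg hsub fun _ _ _ => by positivity
      _ = ∑ k ∈ Finset.Icc 1 M, (1 / p) * ((k : ℝ)⁻¹) := by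
          rw [Finset.sum_image fun a _ b _ h => hinj h]
          refine Finset.sum_congr rfl fun k _ => ?_
          push_cast
          rw [abs_mul, hs1', one_mul, abs_of_nonneg (by positivity)]
          rw [one_div, mul_inv, one_div]
      _ = (1 / p) * (harmonic M : ℝ) := by
          rw [← Finset.mul_sum, harmonic_eq_sum_Icc]
          push_cast
          rfl
      _ ≤ (1 / p) * (1 + Real.log M) := by
          gcongr
          exact harmonic_le_one_add_log M
      _ = _ := by ring
  rw [← Finset.sum_filter_add_sum_filter_not S (fun m => 0 < m)]
  have h1 := key 1 (Or.inl rfl) (S.filter fun m => 0 < m) (by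
    intro m hm
    rw [Finset.mem_filter] at hm
    exact ⟨by simpa using hm.2, (hS m hm.1).2⟩)
  have h2 := key (-1) (Or.inr rfl) (S.filter fun m => ¬ 0 < m) (by
    intro m hm
    rw [Finset.mem_filter] at hm
    have := (hS m hm.1).1
    exact ⟨by omega, (hS m hm.1).2⟩)
  rw [mul_div_assoc]
  linarith

/-- The nonzero triples `(u, v, w)` with `4 ^ i |u| v²` and `4 ^ i |u| w²` at most `M`. -/
noncomputable def scaleTriples (M i : ℕ) : Finset (ℤ × ℤ × ℤ) :=
  (Finset.Icc (-M : ℤ) M ×ˢ Finset.Icc (-M : ℤ) M ×ˢ Finset.Icc (-M : ℤ) M).filter fun θ =>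
    θ.1 ≠ 0 ∧ θ.2.1 ≠ 0 ∧ θ.2.2 ≠ 0 ∧
      4 ^ i * (|θ.1| * θ.2.1 ^ 2) ≤ M ∧ 4 ^ i * (|θ.1| * θ.2.2 ^ 2) ≤ M

theorem mem_scaleTriples {M i : ℕ} {u v w : ℤ} : (u, v, w) ∈ scaleTriples M i ↔
    u ≠ 0 ∧ v ≠ 0 ∧ w ≠ 0 ∧ 4 ^ i * (|u| * v ^ 2) ≤ M ∧ 4 ^ i * (|u| * w ^ 2) ≤ M := by
  simp only [scaleTriples, Finset.mem_filter, Finset.mem_product, and_iff_right_iff_imp,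
    Finset.mem_Icc, ← abs_le]
  rintro ⟨hu, hv, hw, h1, h2⟩
  have h4 : (1 : ℤ) ≤ 4 ^ i := one_le_pow₀ (by norm_num)
  have hu := Int.one_le_abs hu
  have hv := Int.one_le_abs hv
  have hw := Int.one_le_abs hw
  rw [← sq_abs] at h1 h2
  generalize |u| = U at *
  generalize |v| = V at *
  generalize |w| = W at *
  have key : ∀ Z : ℤ, 1 ≤ Z → 4 ^ i * (U * Z ^ 2) ≤ M → U ≤ M ∧ Z ≤ M := by
    intro Z hZ h
    have a1 : U * Z ^ 2 ≤ 4 ^ i * (U * Z ^ 2) := le_mul_of_one_le_left (by positivity) h4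
    have a2 : U ≤ U * Z ^ 2 := le_mul_of_one_le_right (by positivity) (one_le_pow₀ hZ)
    have a3 : Z ^ 2 ≤ U * Z ^ 2 := le_mul_of_one_le_left (by positivity) hu
    have a4 : Z ≤ Z ^ 2 := le_self_pow₀ hZ (by norm_num)
    constructor <;> linarith
  exact ⟨(key V hv h1).1, (key V hv h1).2, (key W hw h2).2⟩

theorem card_scaleTriples_filter_dvd_le (M i : ℕ) {p q : ℕ} (hp : 0 < p) (hq : 0 < q) :
    (((scaleTriples M i).filter fun θ => (p : ℤ) ∣ θ.1 ∧ (q : ℤ) ∣ θ.2.2).card : ℝ) ≤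
      8 * M / 4 ^ i * (1 + Real.log M) / (p * q) := by
  classical
  set S := (scaleTriples M i).filter fun θ => (p : ℤ) ∣ θ.1 ∧ (q : ℤ) ∣ θ.2.2 with hS
  set A := S.image Prod.fst with hA
  have hmem : ∀ u v w : ℤ, (u, v, w) ∈ S → u ≠ 0 ∧ v ≠ 0 ∧ w ≠ 0 ∧
      4 ^ i * (|u| * v ^ 2) ≤ M ∧ 4 ^ i * (|u| * w ^ 2) ≤ M ∧ (p : ℤ) ∣ u ∧ (q : ℤ) ∣ w := by
    intro u v w h
    rw [hS, Finset.mem_filter, mem_scaleTriples] at h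
    tauto
  have hAmem : ∀ u ∈ A, u ≠ 0 ∧ (p : ℤ) ∣ u ∧ |u| ≤ M := by
    intro u hu
    obtain ⟨⟨u', v, w⟩, h, rfl⟩ := Finset.mem_image.mp hu
    have h' := hmem _ _ _ h
    refine ⟨h'.1, h'.2.2.2.2.2.1, ?_⟩
    have h2 := (Finset.mem_filter.mp (Finset.mem_filter.mp h).1).1
    rw [Finset.mem_product, Finset.mem_Icc, ← abs_le] at h2
    exact h2.1
  have hfib : ∀ u ∈ A, ((S.filter fun θ => θ.1 = u).card : ℝ) ≤
      4 * M / (4 ^ i * q) * (1 / |(u : ℝ)|) := by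
    intro u hu
    have hu0 : (u : ℝ) ≠ 0 := by exact_mod_cast (hAmem u hu).1
    set T := S.filter fun θ => θ.1 = u with hT
    set Y : ℝ := M / (4 ^ i * |(u : ℝ)|) with hY
    have hY0 : 0 ≤ Y := by positivity
    have hTm : ∀ θ ∈ T, (θ.2.1 ≠ 0 ∧ (θ.2.1 : ℝ) ^ 2 ≤ Y) ∧
        (θ.2.2 ≠ 0 ∧ (q : ℤ) ∣ θ.2.2 ∧ (θ.2.2 : ℝ) ^ 2 ≤ Y) := by
      rintro ⟨u', v, w⟩ h
      rw [hT, Finset.mem_filter] at h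
      obtain ⟨h, rfl⟩ := h
      obtain ⟨-, hv, hw, h1, h2, -, hqw⟩ := hmem _ _ _ h
      have hb : ∀ m : ℤ, 4 ^ i * (|u'| * m ^ 2) ≤ (M : ℤ) → (m : ℝ) ^ 2 ≤ Y := by
        intro m hm
        have hm' : (4 : ℝ) ^ i * (|(u' : ℝ)| * (m : ℝ) ^ 2) ≤ M := by exact_mod_cast hm
        rw [hY, le_div_iff₀ (by positivity)]
        linarith
      exact ⟨⟨hv, hb v h1⟩, hw, hqw, hb w h2⟩
    have hle : T.card ≤ (T.image fun θ => θ.2.1).card * (T.image fun θ => θ.2.2).card := by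
      rw [← Finset.card_product]
      refine Finset.card_le_card_of_injOn Prod.snd ?_ ?_
      · intro θ hθ
        exact Finset.mem_product.mpr
          ⟨Finset.mem_image.mpr ⟨θ, hθ, rfl⟩, Finset.mem_image.mpr ⟨θ, hθ, rfl⟩⟩
      · intro θ hθ θ' hθ' e
        exact Prod.ext ((Finset.mem_filter.mp hθ).2.trans (Finset.mem_filter.mp hθ').2.symm) e
    have c1 : ((T.image fun θ => θ.2.1).card : ℝ) ≤ 2 * √Y / (1 : ℕ) :=
      card_nonzero_multiples_le one_pos fun m hm => by
        obtain ⟨θ, hθ, rfl⟩ := Finset.mem_image.mp hm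
        exact ⟨(hTm θ hθ).1.1, by simp, (hTm θ hθ).1.2⟩
    have c2 : ((T.image fun θ => θ.2.2).card : ℝ) ≤ 2 * √Y / q :=
      card_nonzero_multiples_le hq fun m hm => by
        obtain ⟨θ, hθ, rfl⟩ := Finset.mem_image.mp hm
        exact (hTm θ hθ).2
    calc (T.card : ℝ)
        ≤ (T.image fun θ => θ.2.1).card * (T.image fun θ => θ.2.2).card := by exact_mod_cast hle
      _ ≤ (2 * √Y / (1 : ℕ)) * (2 * √Y / q) := by gcongr
      _ = 4 * (√Y * √Y) / q := by push_cast; ring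
      _ = 4 * M / (4 ^ i * q) * (1 / |(u : ℝ)|) := by
          rw [Real.mul_self_sqrt hY0, hY]
          field_simp
  rw [Finset.card_eq_sum_card_fiberwise (f := Prod.fst) (t := A)
    (fun θ hθ => Finset.mem_image_of_mem _ hθ)]
  push_cast
  calc ∑ u ∈ A, ((S.filter fun θ => θ.1 = u).card : ℝ)
      ≤ ∑ u ∈ A, 4 * M / (4 ^ i * q) * (1 / |(u : ℝ)|) := Finset.sum_le_sum hfib
    _ = 4 * M / (4 ^ i * q) * ∑ u ∈ A, (1 / |(u : ℝ)|) := by rw [Finset.mul_sum]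
    _ ≤ 4 * M / (4 ^ i * q) * (2 * (1 + Real.log M) / p) := by
        gcongr
        exact sum_one_div_abs_multiples_le hp hAmem
    _ = _ := by
        have hp' : (p : ℝ) ≠ 0 := by positivity
        have hq' : (q : ℝ) ≠ 0 := by positivity
        field_simp
        ring

/-- The quartic with first coefficient and resolvent root `(a, x)` and resolvent data
`(u, v, w)`. -/
def quarticOfData (u v w : ℤ) (P : ℤ × ℤ) : ℤ × ℤ × ℤ × ℤ :=
  (P.1, (P.1 ^ 2 + 4 * P.2 - u * w ^ 2) / 4, (P.1 * P.2 - u * v * w) / 2,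
    (P.2 ^ 2 - u * v ^ 2) / 4)

theorem sum_card_normSquareBox_le {s : Finset ℕ} (hs : ∀ p ∈ s, p.Prime ∧ 16 ≤ p) {i : ℕ}
    (hi : ∏ p ∈ s, p ≤ 2 ^ i) {δ : ℝ} (hδ : (3 / 4) ^ s.card ≤ δ)
    (hδ' : ∑ p ∈ s, (1 / p : ℝ) ≤ δ) {M : ℕ} (hM : 1 ≤ M) (ε : ℤ) (e : Bool) :
    ∑ θ ∈ scaleTriples M i, ((normSquareBox (2 ^ (i + 2)) (boxCorner i ε θ.1 θ.2.2)
      (boxCorner i ε θ.1 θ.2.1) (bif e then 1 else θ.1 * θ.2.2 ^ 2) θ.1 θ.2.1 θ.2.2).card : ℝ) ≤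
      768 * (M * (1 + Real.log M)) * δ := by
  have hlog : 0 ≤ Real.log M := Real.log_nonneg (by exact_mod_cast hM)
  have hle : ∏ p ∈ s, p ≤ 2 ^ (i + 2) := hi.trans (Nat.pow_le_pow_right (by norm_num) (by omega))
  set A : ℝ := 8 * M / 4 ^ i * (1 + Real.log M) with hA
  have hA0 : 0 ≤ A := by positivity
  have c0 : ((scaleTriples M i).card : ℝ) ≤ A := by
    have := card_scaleTriples_filter_dvd_le M i one_pos one_pos
    simpa using this
  have cu : ∀ p ∈ s, ∑ θ ∈ scaleTriples M i, (if (p : ℤ) ∣ θ.1 then (1 : ℝ) else 0) ≤ A * (1 / p) := by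
    intro p hp
    have := card_scaleTriples_filter_dvd_le M i (hs p hp).1.pos one_pos
    rw [Finset.sum_boole]
    simpa [hA, div_eq_mul_inv] using this
  have cw : ∀ p ∈ s, ∑ θ ∈ scaleTriples M i, (if (p : ℤ) ∣ θ.2.2 then (1 : ℝ) else 0) ≤ A * (1 / p) := by
    intro p hp
    have := card_scaleTriples_filter_dvd_le M i one_pos (hs p hp).1.pos
    rw [Finset.sum_boole]
    simpa [hA, div_eq_mul_inv] using this
  calc ∑ θ ∈ scaleTriples M i, ((normSquareBox (2 ^ (i + 2)) (boxCorner i ε θ.1 θ.2.2)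
      (boxCorner i ε θ.1 θ.2.1) (bif e then 1 else θ.1 * θ.2.2 ^ 2) θ.1 θ.2.1 θ.2.2).card : ℝ)
      ≤ ∑ θ ∈ scaleTriples M i, ((2 ^ (i + 2) : ℕ) : ℝ) ^ 2 * (4 * (3 / 4) ^ s.card +
      ∑ p ∈ s, ((if (p : ℤ) ∣ θ.1 then 1 else 0) + (if (p : ℤ) ∣ θ.2.2 then 1 else 0))) :=
        Finset.sum_le_sum fun θ _ => card_normSquareBox_le_add hs hle _ _ _ (by cases e <;> simp)
    _ = ((2 ^ (i + 2) : ℕ) : ℝ) ^ 2 * ((scaleTriples M i).card * (4 * (3 / 4) ^ s.card) +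
          ∑ p ∈ s, ((∑ θ ∈ scaleTriples M i, (if (p : ℤ) ∣ θ.1 then (1 : ℝ) else 0)) +
            ∑ θ ∈ scaleTriples M i, (if (p : ℤ) ∣ θ.2.2 then (1 : ℝ) else 0))) := by
        rw [← Finset.mul_sum, Finset.sum_add_distrib, Finset.sum_const, nsmul_eq_mul,
          Finset.sum_comm]
        simp only [Finset.sum_add_distrib]
    _ ≤ ((2 ^ (i + 2) : ℕ) : ℝ) ^ 2 * (A * (4 * δ) + ∑ p ∈ s, (A * (1 / p) + A * (1 / p))) := by
        gcongr with p hp p hp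
        · exact cu p hp
        · exact cw p hp
    _ = ((2 ^ (i + 2) : ℕ) : ℝ) ^ 2 * A * (4 * δ + 2 * ∑ p ∈ s, (1 / p : ℝ)) := by
        rw [Finset.sum_add_distrib, ← Finset.mul_sum]
        ring
    _ ≤ ((2 ^ (i + 2) : ℕ) : ℝ) ^ 2 * A * (4 * δ + 2 * δ) := by gcongr
    _ = 768 * (M * (1 + Real.log M)) * δ := by
        have h4 : ((2 ^ (i + 2) : ℕ) : ℝ) ^ 2 = 16 * 4 ^ i := by
          push_cast
          rw [pow_add, mul_pow, ← pow_mul, mul_comm i 2, pow_mul]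
          norm_num
          ring
        rw [h4, hA]
        field_simp
        ring

theorem exists_card_nondegenerate_le : ∃ K : ℝ, 0 < K ∧ ∀ N : ℕ, 2 ≤ N →
    ∀ S : Finset (ℤ × ℤ × ℤ × ℤ), (∀ P ∈ S, |P.1| ≤ N ∧ |P.2.1| ≤ N ∧ |P.2.2.1| ≤ N ∧
      |P.2.2.2| ≤ N ∧ ∃ x y : ℤ,
      (P.1 ^ 2 - 4 * P.2.1 + 4 * x) * (x ^ 2 - 4 * P.2.2.2) = (2 * P.2.2.1 - P.1 * x) ^ 2 ∧
      P.1 ^ 2 - 4 * P.2.1 + 4 * x ≠ 0 ∧ x ^ 2 - 4 * P.2.2.2 ≠ 0 ∧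
      ((P.2.1 - x) ^ 2 - 4 * P.1 * P.2.2.1 + 4 * (P.2.1 - x) * x + 16 * P.2.2.2 = y ^ 2 ∨
      (P.1 ^ 2 - 4 * P.2.1 + 4 * x) *
        ((P.2.1 - x) ^ 2 - 4 * P.1 * P.2.2.1 + 4 * (P.2.1 - x) * x + 16 * P.2.2.2) = y ^ 2)) →
    (S.card : ℝ) ≤ K * (N ^ 2 * (1 + Real.log (((32 * N) ^ 2 : ℕ) : ℝ))) := by
  classical
  obtain ⟨s, hs1, hs2, hs3, hs4⟩ := exists_sieve_sets
  obtain ⟨C, hC0, hC⟩ := exists_sum_three_quarters_pow_le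
  refine ⟨6 * 768 * 1024 * C, by positivity, fun N hN S hS => ?_⟩
  set M : ℕ := (32 * N) ^ 2 with hMdef
  have hM1 : 1 ≤ M := Nat.one_le_pow _ _ (by omega)
  have hlog : 0 ≤ Real.log M := Real.log_nonneg (by exact_mod_cast hM1)
  let E : Finset (ℤ × Bool) := ({-1, 0, 1} : Finset ℤ) ×ˢ Finset.univ
  let B : ℕ → ℤ × ℤ × ℤ → ℤ × Bool → Finset (ℤ × ℤ) := fun i θ e =>
    normSquareBox (2 ^ (i + 2)) (boxCorner i e.1 θ.1 θ.2.2)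
      (boxCorner i e.1 θ.1 θ.2.1) (bif e.2 then 1 else θ.1 * θ.2.2 ^ 2) θ.1 θ.2.1 θ.2.2
  have hcover : S ⊆ (Finset.range (32 * N)).biUnion fun i => E.biUnion fun e =>
      (scaleTriples M i).biUnion fun θ => (B i θ e).image (quarticOfData θ.1 θ.2.1 θ.2.2) := by
    rintro ⟨a, b, c, d⟩ hP
    obtain ⟨ha, hb, hc, hd, x, y, hres, hU, hV, hy⟩ := hS _ hP
    obtain ⟨u, v, w, hu, hv, hw, eU, eV, ek, ⟨t, z, ht, hz⟩, i, hi, hi1, hi2, ε, hε, hbox1, hbox2⟩ :=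
      exists_parametrization hN ha hb hc hd hres hU hV hy
    simp only [Finset.mem_biUnion, Finset.mem_range, Finset.mem_image]
    refine ⟨i, hi, (ε, decide (t = 1)), Finset.mem_product.mpr ⟨hε, Finset.mem_univ _⟩, (u, v, w),
      mem_scaleTriples.mpr ⟨hu, hv, hw, ?_, ?_⟩, (a, x), ?_, ?_⟩
    · rw [hMdef]; push_cast; exact hi1
    · rw [hMdef]; push_cast; exact hi2
    · refine Finset.mem_filter.mpr ⟨Finset.mem_product.mpr ⟨?_, ?_⟩, z, ?_⟩
      · push_cast; exact hbox1
      · push_cast; exact hbox2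
      · simp only
        have : (bif decide (t = 1) then 1 else u * w ^ 2) = t := by
          by_cases h1 : t = 1
          · simp [h1]
          · simp only [h1, decide_false, cond_false]
            exact (ht.resolve_left h1).symm
        rw [this]
        exact hz
    · have hb' : (a ^ 2 + 4 * x - u * w ^ 2) / 4 = b := by rw [← eU]; ring_nf; omega
      have hc' : (a * x - u * v * w) / 2 = c := by rw [← ek]; ring_nf; omega
      have hd' : (x ^ 2 - u * v ^ 2) / 4 = d := by rw [← eV]; ring_nf; omega
      simp only [quarticOfData, hb', hc', hd']
  have hcard : S.card ≤ ∑ i ∈ Finset.range (32 * N), ∑ e ∈ E, ∑ θ ∈ scaleTriples M i,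
      (B i θ e).card := by
    refine (Finset.card_le_card hcover).trans (Finset.card_biUnion_le.trans ?_)
    refine Finset.sum_le_sum fun i _ => Finset.card_biUnion_le.trans ?_
    refine Finset.sum_le_sum fun e _ => Finset.card_biUnion_le.trans ?_
    exact Finset.sum_le_sum fun θ _ => Finset.card_image_le
  have hE : (E.card : ℝ) = 6 := by
    have : E.card = 6 := by rw [Finset.card_product]; rfl
    exact_mod_cast this
  calc (S.card : ℝ) ≤ ∑ i ∈ Finset.range (32 * N), ∑ e ∈ E, ∑ θ ∈ scaleTriples M i,
        ((B i θ e).card : ℝ) := by exact_mod_cast hcard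
    _ ≤ ∑ i ∈ Finset.range (32 * N), ∑ e ∈ E,
        768 * (M * (1 + Real.log M)) * (3 / 4) ^ Nat.sqrt (i / 7) :=
        Finset.sum_le_sum fun i _ => Finset.sum_le_sum fun e _ =>
          sum_card_normSquareBox_le (hs2 i) (hs3 i) (by rw [hs1]) (hs4 i) hM1 e.1 e.2
    _ = 6 * (768 * (M * (1 + Real.log M))) *
          ∑ i ∈ Finset.range (32 * N), (3 / 4 : ℝ) ^ Nat.sqrt (i / 7) := by
        simp only [Finset.sum_const, nsmul_eq_mul, hE]
        rw [Finset.mul_sum]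
        exact Finset.sum_congr rfl fun _ _ => by ring
    _ ≤ 6 * (768 * (M * (1 + Real.log M))) * C := by gcongr; exact hC _
    _ = _ := by
        have : (M : ℝ) = 1024 * N ^ 2 := by rw [hMdef]; push_cast; ring
        rw [show (6 * (768 * (M * (1 + Real.log M))) * C : ℝ)
          = 6 * 768 * C * (M * (1 + Real.log M)) by ring]
        nth_rewrite 1 [this]
        ring

theorem card_pairs_abs_mul_le {N : ℕ} (hN : 1 ≤ N) {S : Finset (ℤ × ℤ)}
    (hS : ∀ P ∈ S, |P.1| ≤ N ∧ |P.2| ≤ 3 * N ∧ |P.1 * P.2| ≤ 2 * N) :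
    (S.card : ℝ) ≤ 17 * (N * (1 + Real.log N)) := by
  classical
  have hN1 : (1 : ℝ) ≤ N := by exact_mod_cast hN
  have hlog : 0 ≤ Real.log N := Real.log_nonneg hN1
  have h0 : ((S.filter fun P => P.1 = 0).card : ℝ) ≤ 7 * N := by
    have : (S.filter fun P => P.1 = 0).card ≤ (Finset.Icc (-(3 * N) : ℤ) (3 * N)).card := by
      refine Finset.card_le_card_of_injOn Prod.snd ?_ ?_
      · intro P hP
        have := (hS P (Finset.mem_filter.mp hP).1).2.1
        exact Finset.mem_Icc.mpr (abs_le.mp this)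
      · intro P hP P' hP' e
        exact Prod.ext ((Finset.mem_filter.mp hP).2.trans (Finset.mem_filter.mp hP').2.symm) e
    rw [Int.card_Icc] at this
    have h7 : (S.filter fun P => P.1 = 0).card ≤ 7 * N := by omega
    exact_mod_cast h7
  set T := S.filter fun P => ¬ P.1 = 0 with hT
  set A := T.image Prod.fst with hA
  have hAm : ∀ a ∈ A, a ≠ 0 ∧ ((1 : ℕ) : ℤ) ∣ a ∧ |a| ≤ N := by
    intro a ha
    obtain ⟨P, hP, rfl⟩ := Finset.mem_image.mp ha
    rw [hT, Finset.mem_filter] at hP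
    exact ⟨hP.2, by simp, (hS P hP.1).1⟩
  have hAcard : (A.card : ℝ) ≤ 2 * N := by
    have := card_nonzero_multiples_le (q := 1) one_pos (Y := (N : ℝ) ^ 2) (S := A) fun a ha => by
      refine ⟨(hAm a ha).1, (hAm a ha).2.1, ?_⟩
      have : |(a : ℝ)| ≤ N := by exact_mod_cast (hAm a ha).2.2
      rw [← sq_abs]
      gcongr
    rwa [Real.sqrt_sq (by positivity), Nat.cast_one, div_one] at this
  have hfib : ∀ a ∈ A, ((T.filter fun P => P.1 = a).card : ℝ) ≤ 4 * N * (1 / |(a : ℝ)|) + 1 := by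
    intro a ha
    have ha0 : (a : ℝ) ≠ 0 := by exact_mod_cast (hAm a ha).1
    set F := T.filter fun P => P.1 = a with hF
    have hFm : ∀ P ∈ F, P.1 = a ∧ |a * P.2| ≤ 2 * N := by
      intro P hP
      rw [hF, hT, Finset.mem_filter, Finset.mem_filter] at hP
      have := (hS P hP.1.1).2.2
      rw [hP.2] at this
      exact ⟨hP.2, this⟩
    have h1 : F.card ≤ (F.image Prod.snd).card := by
      refine Finset.card_le_card_of_injOn Prod.snd (fun P hP => Finset.mem_image_of_mem _ hP) ?_
      intro P hP P' hP' e
      exact Prod.ext ((hFm P hP).1.trans (hFm P' hP').1.symm) e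
    have h2 : (F.image Prod.snd).card ≤ ((F.image Prod.snd).erase 0).card + 1 := by
      have := Finset.pred_card_le_card_erase (s := F.image Prod.snd) (a := 0)
      omega
    have h3 := card_nonzero_multiples_le (q := 1) one_pos (Y := (2 * N / |(a : ℝ)|) ^ 2)
      (S := (F.image Prod.snd).erase 0) fun m hm => by
        obtain ⟨hm0, hm⟩ := Finset.mem_erase.mp hm
        obtain ⟨P, hP, rfl⟩ := Finset.mem_image.mp hm
        refine ⟨hm0, by simp, ?_⟩
        have h4 : |(a : ℝ) * P.2| ≤ 2 * N := by exact_mod_cast (hFm P hP).2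
        rw [← sq_abs]
        gcongr
        rw [le_div_iff₀ (by positivity), mul_comm, ← abs_mul]
        exact h4
    rw [Real.sqrt_sq (by positivity), Nat.cast_one, div_one] at h3
    have h4 : (F.card : ℝ) ≤ ((F.image Prod.snd).erase 0).card + 1 := by
      exact_mod_cast h1.trans h2
    refine h4.trans (add_le_add_left (h3.trans (le_of_eq (by ring))) 1)
  have hTc : (T.card : ℝ) ≤ 8 * (N * (1 + Real.log N)) + 2 * N := by
    rw [Finset.card_eq_sum_card_fiberwise (f := Prod.fst) (t := A)
      (fun θ hθ => Finset.mem_image_of_mem _ hθ)]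
    push_cast
    calc ∑ a ∈ A, ((T.filter fun P => P.1 = a).card : ℝ)
        ≤ ∑ a ∈ A, (4 * N * (1 / |(a : ℝ)|) + 1) := Finset.sum_le_sum hfib
      _ = 4 * N * ∑ a ∈ A, (1 / |(a : ℝ)|) + A.card := by
          rw [Finset.sum_add_distrib, Finset.mul_sum, Finset.sum_const, nsmul_eq_mul, mul_one]
      _ ≤ 4 * N * (2 * (1 + Real.log N) / (1 : ℕ)) + 2 * N := by
          gcongr
          exact sum_one_div_abs_multiples_le one_pos hAm
      _ = _ := by push_cast; ring
  have hsplit : (S.card : ℝ) = (S.filter fun P => P.1 = 0).card + T.card := by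
    exact_mod_cast (Finset.card_filter_add_card_filter_not (s := S) (fun P => P.1 = 0)).symm
  have : (N : ℝ) ≤ N * (1 + Real.log N) := le_mul_of_one_le_right (by positivity) (by linarith)
  linarith

theorem card_degenerate_le {N : ℕ} (hN : 1 ≤ N) {S : Finset (ℤ × ℤ × ℤ × ℤ)}
    (hS : ∀ P ∈ S, |P.1| ≤ N ∧ |P.2.1| ≤ N ∧ |P.2.2.1| ≤ N ∧ |P.2.2.2| ≤ N ∧
      ∃ x : ℤ, |x| ≤ 3 * N ∧ 2 * P.2.2.1 = P.1 * x ∧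
        (P.1 ^ 2 - 4 * P.2.1 + 4 * x = 0 ∨ x ^ 2 - 4 * P.2.2.2 = 0)) :
    (S.card : ℝ) ≤ 102 * (N ^ 2 * (1 + Real.log N)) := by
  classical
  have hN1 : (1 : ℝ) ≤ N := by exact_mod_cast hN
  have hlog : 0 ≤ Real.log N := Real.log_nonneg hN1
  let A : Finset (ℤ × ℤ) := (Finset.Icc (-N : ℤ) N ×ˢ Finset.Icc (-(3 * N) : ℤ) (3 * N)).filter
    fun P => |P.1 * P.2| ≤ 2 * N
  let I : Finset ℤ := Finset.Icc (-N : ℤ) N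
  let f : (ℤ × ℤ) × ℤ → ℤ × ℤ × ℤ × ℤ := fun Q =>
    (Q.1.1, (Q.1.1 ^ 2 + 4 * Q.1.2) / 4, Q.1.1 * Q.1.2 / 2, Q.2)
  let g : (ℤ × ℤ) × ℤ → ℤ × ℤ × ℤ × ℤ := fun Q =>
    (Q.1.1, Q.2, Q.1.1 * Q.1.2 / 2, Q.1.2 ^ 2 / 4)
  have hA : (A.card : ℝ) ≤ 17 * (N * (1 + Real.log N)) := card_pairs_abs_mul_le hN fun P hP => by
    obtain ⟨h1, h2⟩ := Finset.mem_filter.mp hP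
    obtain ⟨h3, h4⟩ := Finset.mem_product.mp h1
    exact ⟨abs_le.mpr (Finset.mem_Icc.mp h3), abs_le.mpr (Finset.mem_Icc.mp h4), h2⟩
  have hI : (I.card : ℝ) ≤ 3 * N := by
    have : I.card ≤ 3 * N := by rw [Int.card_Icc]; omega
    exact_mod_cast this
  have hcover : S ⊆ (A ×ˢ I).image f ∪ (A ×ˢ I).image g := by
    rintro ⟨a, b, c, d⟩ hP
    obtain ⟨ha, hb, hc, hd, x, hx, hcx, h⟩ := hS _ hP
    simp only at ha hb hc hd hcx h
    have hAx : (a, x) ∈ A := by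
      refine Finset.mem_filter.mpr ⟨Finset.mem_product.mpr
        ⟨Finset.mem_Icc.mpr (abs_le.mp ha), Finset.mem_Icc.mpr (abs_le.mp hx)⟩, ?_⟩
      simp only
      rw [← hcx, abs_mul, abs_two]
      linarith
    have hc' : a * x / 2 = c := by rw [← hcx]; omega
    rw [Finset.mem_union]
    rcases h with h | h
    · left
      refine Finset.mem_image.mpr ⟨((a, x), d), Finset.mem_product.mpr
        ⟨hAx, Finset.mem_Icc.mpr (abs_le.mp hd)⟩, ?_⟩
      have hb' : (a ^ 2 + 4 * x) / 4 = b := by omega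
      simp only [f, hb', hc']
    · right
      refine Finset.mem_image.mpr ⟨((a, x), b), Finset.mem_product.mpr
        ⟨hAx, Finset.mem_Icc.mpr (abs_le.mp hb)⟩, ?_⟩
      have hd' : x ^ 2 / 4 = d := by omega
      simp only [g, hd', hc']
  have hcard : S.card ≤ 2 * (A.card * I.card) := by
    refine (Finset.card_le_card hcover).trans ((Finset.card_union_le _ _).trans ?_)
    rw [two_mul, ← Finset.card_product]
    exact add_le_add Finset.card_image_le Finset.card_image_le
  calc (S.card : ℝ) ≤ 2 * (A.card * I.card) := by exact_mod_cast hcard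
    _ ≤ 2 * ((17 * (N * (1 + Real.log N))) * (3 * N)) := by gcongr
    _ = _ := by ring

open Polynomial in
/-- The coefficient vectors of height at most `H` of irreducible quartics whose Galois group has
order `4`. -/
def orderFourQuartics (H : ℝ) : Set (ℤ × ℤ × ℤ × ℤ) :=
  {P | |(P.1 : ℝ)| ≤ H ∧ |(P.2.1 : ℝ)| ≤ H ∧ |(P.2.2.1 : ℝ)| ≤ H ∧ |(P.2.2.2 : ℝ)| ≤ H ∧
    Irreducible (X ^ 4 + C (P.1 : ℚ) * X ^ 3 + C (P.2.1 : ℚ) * X ^ 2 + C (P.2.2.1 : ℚ) * X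
        + C (P.2.2.2 : ℚ)) ∧
    Nat.card ((X ^ 4 + C (P.1 : ℚ) * X ^ 3 + C (P.2.1 : ℚ) * X ^ 2 + C (P.2.2.1 : ℚ) * X
        + C (P.2.2.2 : ℚ)).Gal) = 4}

theorem abs_le_natFloor {H : ℝ} {n : ℤ} (h : |(n : ℝ)| ≤ H) : |n| ≤ (⌊H⌋₊ : ℤ) := by
  rw [← Int.natCast_natAbs]
  have : ((n.natAbs : ℕ) : ℝ) ≤ H := by rwa [Nat.cast_natAbs, Int.cast_abs]
  exact_mod_cast Nat.le_floor this

theorem finite_orderFourQuartics (H : ℝ) : (orderFourQuartics H).Finite := by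
  set I := Finset.Icc (-(⌊H⌋₊ : ℤ)) ⌊H⌋₊
  refine (I ×ˢ I ×ˢ I ×ˢ I).finite_toSet.subset ?_
  rintro ⟨a, b, c, d⟩ ⟨ha, hb, hc, hd, -⟩
  have key : ∀ n : ℤ, |(n : ℝ)| ≤ H → n ∈ I := fun n hn =>
    Finset.mem_Icc.mpr (abs_le.mp (abs_le_natFloor hn))
  simp only [Finset.coe_product, Set.mem_prod, Finset.mem_coe]
  exact ⟨key a ha, key b hb, key c hc, key d hd⟩

theorem quarticGalCount_le (G : Type) [Group G] (hG : Nat.card G = 4) (H : ℝ) :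
    quarticGalCount G H ≤ (orderFourQuartics H).ncard := by
  refine Set.ncard_le_ncard ?_ (finite_orderFourQuartics H)
  rintro P ⟨ha, hb, hc, hd, hirr, ⟨e⟩⟩
  exact ⟨ha, hb, hc, hd, hirr, (Nat.card_congr e.toEquiv).trans hG⟩

theorem exists_ncard_orderFourQuartics_le : ∃ K : ℝ, 0 < K ∧ ∀ H : ℝ, 2 ≤ H →
    ((orderFourQuartics H).ncard : ℝ) ≤ K * (H ^ 2 * Real.log H) := by
  classical
  obtain ⟨K, hK0, hK⟩ := exists_card_nondegenerate_le
  refine ⟨14 * K + 102 * 14, by positivity, fun H hH => ?_⟩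
  set N := ⌊H⌋₊ with hNdef
  have hN2 : 2 ≤ N := Nat.le_floor (by exact_mod_cast hH)
  have hNH : (N : ℝ) ≤ H := Nat.floor_le (by linarith)
  have hN2' : (2 : ℝ) ≤ N := by exact_mod_cast hN2
  have hfin := finite_orderFourQuartics H
  set S := hfin.toFinset with hS
  set D := S.filter fun P => ∃ x : ℤ, |x| ≤ 3 * N ∧ 2 * P.2.2.1 = P.1 * x ∧
        (P.1 ^ 2 - 4 * P.2.1 + 4 * x = 0 ∨ x ^ 2 - 4 * P.2.2.2 = 0) with hD
  set E := S.filter fun P => ¬ ∃ x : ℤ, |x| ≤ 3 * N ∧ 2 * P.2.2.1 = P.1 * x ∧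
        (P.1 ^ 2 - 4 * P.2.1 + 4 * x = 0 ∨ x ^ 2 - 4 * P.2.2.2 = 0) with hE
  have hSN : ∀ P ∈ S, |P.1| ≤ N ∧ |P.2.1| ≤ N ∧ |P.2.2.1| ≤ N ∧ |P.2.2.2| ≤ N := by
    intro P hP
    obtain ⟨ha, hb, hc, hd, -⟩ := hfin.mem_toFinset.mp hP
    exact ⟨abs_le_natFloor ha, abs_le_natFloor hb, abs_le_natFloor hc, abs_le_natFloor hd⟩
  have hDc : (D.card : ℝ) ≤ 102 * (N ^ 2 * (1 + Real.log N)) := by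
    refine card_degenerate_le (by omega) fun P hP => ?_
    obtain ⟨hP, hx⟩ := Finset.mem_filter.mp hP
    obtain ⟨ha, hb, hc, hd⟩ := hSN P hP
    exact ⟨ha, hb, hc, hd, hx⟩
  have hEc : (E.card : ℝ) ≤ K * (N ^ 2 * (1 + Real.log (((32 * N) ^ 2 : ℕ) : ℝ))) := by
    refine hK N hN2 E fun P hP => ?_
    obtain ⟨hP, hx⟩ := Finset.mem_filter.mp hP
    obtain ⟨ha, hb, hc, hd⟩ := hSN P hP
    refine ⟨ha, hb, hc, hd, ?_⟩
    obtain ⟨-, -, -, -, hirr, hcard⟩ := hfin.mem_toFinset.mp hP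
    obtain ⟨x, y, h1, -, h3⟩ := exists_resolvent_root hirr hcard
    have hx3 := abs_resolvent_root_le (by exact_mod_cast hN2) ha hb hc hd h1
    have hne : ¬ ((P.1 ^ 2 - 4 * P.2.1 + 4 * x) * (x ^ 2 - 4 * P.2.2.2) = 0) := by
      intro h0
      refine hx ⟨x, hx3, ?_, mul_eq_zero.mp h0⟩
      rw [h0] at h1
      have := pow_eq_zero_iff (two_ne_zero) |>.mp h1.symm
      linarith
    exact ⟨x, y, h1, left_ne_zero_of_mul hne, right_ne_zero_of_mul hne, h3⟩
  have hsplit : ((orderFourQuartics H).ncard : ℝ) = D.card + E.card := by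
    rw [Set.ncard_eq_toFinset_card _ hfin]
    exact_mod_cast (Finset.card_filter_add_card_filter_not (s := S) _).symm
  have hlog2 : Real.log 2 ≤ Real.log N := Real.log_le_log (by norm_num) hN2'
  have hlogN : Real.log N ≤ Real.log H := Real.log_le_log (by linarith) hNH
  have hl2 : 1 / 2 < Real.log 2 := by linarith [Real.log_two_gt_d9]
  have hlogM : Real.log (((32 * N) ^ 2 : ℕ) : ℝ) = 10 * Real.log 2 + 2 * Real.log N := by
    push_cast
    rw [Real.log_pow, Real.log_mul (by norm_num) (by linarith),
      show (32 : ℝ) = 2 ^ 5 by norm_num, Real.log_pow]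
    push_cast
    ring
  have hN2H : (N : ℝ) ^ 2 ≤ H ^ 2 := by gcongr
  have hlH : 0 ≤ Real.log H := by linarith
  have e1 : (N : ℝ) ^ 2 * (1 + Real.log N) ≤ H ^ 2 * (14 * Real.log H) :=
    mul_le_mul hN2H (by linarith) (by linarith) (by positivity)
  have e2 : (N : ℝ) ^ 2 * (1 + Real.log (((32 * N) ^ 2 : ℕ) : ℝ)) ≤ H ^ 2 * (14 * Real.log H) :=
    mul_le_mul hN2H (by rw [hlogM]; linarith) (by rw [hlogM]; linarith) (by positivity)
  rw [hsplit]
  calc (D.card : ℝ) + E.card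
      ≤ 102 * (H ^ 2 * (14 * Real.log H)) + K * (H ^ 2 * (14 * Real.log H)) :=
        add_le_add (hDc.trans (by gcongr)) (hEc.trans (by gcongr))
    _ = _ := by ring

/-- The number of `V₄` and `C₄` quartics is `O(H² log H)`. -/
theorem V4_C4_upper_bound :
    ∃ K : ℝ, 0 < K ∧ ∀ H : ℝ, 2 ≤ H →
      ((quarticGalCount (Multiplicative (ZMod 2 × ZMod 2)) H : ℝ) + (quarticGalCount (Multiplicative (ZMod 4)) H : ℝ))
        ≤ K * H ^ 2 * Real.log H := by
  obtain ⟨K, hK0, hK⟩ := exists_ncard_orderFourQuartics_le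
  refine ⟨2 * K, by positivity, fun H hH => ?_⟩
  have h1 := quarticGalCount_le (Multiplicative (ZMod 2 × ZMod 2)) (by simp) H
  have h2 := quarticGalCount_le (Multiplicative (ZMod 4)) (by simp) H
  have h1' : (quarticGalCount (Multiplicative (ZMod 2 × ZMod 2)) H : ℝ) ≤
    (orderFourQuartics H).ncard := by exact_mod_cast h1
  have h2' : (quarticGalCount (Multiplicative (ZMod 4)) H : ℝ) ≤
    (orderFourQuartics H).ncard := by exact_mod_cast h2
  have := hK H hH
  linarith
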